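/- (Proposition 3, converse part) If X̃ is any self-adjoint extension of X on H satisfying U D(X̃) ⊆ D(X̃), then there exist unitary operators V, W from 𝕳₋ onto 𝕳₊ such that X̃ = X_{V,W}. -/

import Mathlib

open MeasureTheory

noncomputable section

/-- The Hilbert sum `⊕_j L²(ν j)` of `L²`-spaces, as an `l²`-direct sum. -/
abbrev HS {I : Type*} (ν : I → Measure ℝ) : Type _ := lp (fun j => Lp ℂ 2 (ν j)) 2

/-- The measure `t⁻¹ dμ₁` on `[q,1)`. -/
def wd (μ1 : Measure ℝ) : Measure ℝ := μ1.withDensity fun t => ENNReal.ofReal t⁻¹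

/-- `μ` is the measure on `ℝ₊ = (0,∞)` induced by `μ₁` via `μ(qⁿM) = qⁿμ₁(M)`. -/
def IsInducedPlus (q : ℝ) (μ1 μ : Measure ℝ) : Prop :=
  μ (Set.Ioi (0 : ℝ))ᶜ = 0 ∧
  ∀ M : Set ℝ, MeasurableSet M → M ⊆ Set.Ico q 1 → ∀ n : ℤ,
    μ ((fun t => q ^ n * t) '' M) = ENNReal.ofReal (q ^ n) * μ1 M

/-- `μ` is the measure on `ℝ₋ = (−∞,0)` induced by `μ₁` via `μ(−qⁿM) = qⁿμ₁(M)`. -/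
def IsInducedMinus (q : ℝ) (μ1 μ : Measure ℝ) : Prop :=
  μ (Set.Iio (0 : ℝ))ᶜ = 0 ∧
  ∀ M : Set ℝ, MeasurableSet M → M ⊆ Set.Ico q 1 → ∀ n : ℤ,
    μ ((fun t => -(q ^ n * t)) '' M) = ENNReal.ofReal (q ^ n) * μ1 M

/-- `U` acts componentwise by `(Uf)(t) = q^{1/2} f(qt)`. -/
def IsUop (q : ℝ) {I : Type*} (ν : I → Measure ℝ) (U : HS ν ≃ₗᵢ[ℂ] HS ν) : Prop :=
  ∀ f : HS ν, ∀ j : I, ∀ᵐ t ∂(ν j),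
    ((U f : HS ν) j) t = ((q ^ ((1 : ℝ)/2) : ℝ) : ℂ) * ((f : HS ν) j) (q * t)

/-- `P` is the (maximal) multiplication operator `(Pf)(t) = t f(t)`, componentwise. -/
def IsPop {I : Type*} (ν : I → Measure ℝ) (P : HS ν →ₗ.[ℂ] HS ν) : Prop :=
  (∀ f : HS ν, f ∈ P.domain ↔
    ∃ g : HS ν, ∀ j : I, ∀ᵐ t ∂(ν j), (g j) t = (t : ℂ) * (f j) t) ∧
  (∀ f : P.domain, ∀ j : I, ∀ᵐ t ∂(ν j),
    ((P f) j) t = (t : ℂ) * ((f : HS ν) j) t)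

/-- `X` is the symmetric operator `(Xf)(t) = i t⁻¹(f(q⁻¹t) − f(qt))` on
`D(X) = {f : t⁻¹f ∈ H}`, componentwise. -/
def IsXop (q : ℝ) {I : Type*} (ν : I → Measure ℝ) (X : HS ν →ₗ.[ℂ] HS ν) : Prop :=
  (∀ f : HS ν, f ∈ X.domain ↔
    ∃ g : HS ν, ∀ j : I, ∀ᵐ t ∂(ν j), (g j) t = (t : ℂ)⁻¹ * (f j) t) ∧
  (∀ f : X.domain, ∀ j : I, ∀ᵐ t ∂(ν j),
    ((X f) j) t = Complex.I * (t : ℂ)⁻¹ *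
      (((f : HS ν) j) (q⁻¹ * t) - ((f : HS ν) j) (q * t)))

/-- `he` is the "even extension" `h^e` of `h : [q,1) → ℂ` to `ℝ₊`. -/
def IsEvenExt (q : ℝ) (h he : ℝ → ℂ) : Prop :=
  (∀ n : ℕ, ∀ t ∈ Set.Ico q 1, he (q ^ (2 * n) * t) = h t) ∧
  (∀ t : ℝ, (¬ ∃ n : ℕ, ∃ s ∈ Set.Ico q 1, t = q ^ (2 * n) * s) → he t = 0)

/-- `ho` is the "odd extension" `h^o` of `h : [q,1) → ℂ` to `ℝ₊`. -/
def IsOddExt (q : ℝ) (h ho : ℝ → ℂ) : Prop :=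
  (∀ n : ℕ, ∀ t ∈ Set.Ico q 1, ho (q ^ (2 * n + 1) * t) = h t) ∧
  (∀ t : ℝ, (¬ ∃ n : ℕ, ∃ s ∈ Set.Ico q 1, t = q ^ (2 * n + 1) * s) → ho t = 0)

/-- Even extension to the negative half-axis. -/
def IsEvenExtNeg (q : ℝ) (h he : ℝ → ℂ) : Prop :=
  (∀ n : ℕ, ∀ t ∈ Set.Ico q 1, he (-(q ^ (2 * n) * t)) = h t) ∧
  (∀ t : ℝ, (¬ ∃ n : ℕ, ∃ s ∈ Set.Ico q 1, t = -(q ^ (2 * n) * s)) → he t = 0)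

/-- Odd extension to the negative half-axis. -/
def IsOddExtNeg (q : ℝ) (h ho : ℝ → ℂ) : Prop :=
  (∀ n : ℕ, ∀ t ∈ Set.Ico q 1, ho (-(q ^ (2 * n + 1) * t)) = h t) ∧
  (∀ t : ℝ, (¬ ∃ n : ℕ, ∃ s ∈ Set.Ico q 1, t = -(q ^ (2 * n + 1) * s)) → ho t = 0)

/-- `(be, bo, ce, co) ∈ 𝕳₊ ⊕ 𝕳₊ ⊕ 𝕳₋ ⊕ 𝕳₋` are the boundary vectors
`(𝔣_e^+, 𝔣_o^+, 𝔣_e^−, 𝔣_o^−)` of `𝔣 ∈ D(X*)` coming from the componentwise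
decomposition `𝔣 = 𝔣_X + 𝔣^e + 𝔣^o` of Lemma 1. -/
def IsBdry (q : ℝ) {Ip Im : Type*} (μp : Ip → Measure ℝ) (μm : Im → Measure ℝ)
    (μ1p : Ip → Measure ℝ) (μ1m : Im → Measure ℝ)
    (X : HS (Sum.elim μp μm) →ₗ.[ℂ] HS (Sum.elim μp μm))
    (f : HS (Sum.elim μp μm))
    (be bo : HS (fun j => wd (μ1p j))) (ce co : HS (fun j => wd (μ1m j))) : Prop :=
  f ∈ X.adjoint.domain ∧
  ∃ fX : HS (Sum.elim μp μm), fX ∈ X.domain ∧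
    (∀ j : Ip, ∃ he ho : ℝ → ℂ,
      IsEvenExt q (⇑(be j)) he ∧ IsOddExt q (⇑(bo j)) ho ∧
      ∀ᵐ t ∂(μp j), (f (Sum.inl j)) t = (fX (Sum.inl j)) t + he t + ho t) ∧
    (∀ j : Im, ∃ he ho : ℝ → ℂ,
      IsEvenExtNeg q (⇑(ce j)) he ∧ IsOddExtNeg q (⇑(co j)) ho ∧
      ∀ᵐ t ∂(μm j), (f (Sum.inr j)) t = (fX (Sum.inr j)) t + he t + ho t)

/-- Membership in the domain of `X_{V,W}`: `𝔣 ∈ D(X*)` whose boundary vectors satisfy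
`𝔣_e^+ + 𝔣_o^+ = V(𝔣_e^− + 𝔣_o^−)` and `𝔣_e^+ − 𝔣_o^+ = W(𝔣_e^− − 𝔣_o^−)`. -/
def MemXVW (q : ℝ) {Ip Im : Type*} (μp : Ip → Measure ℝ) (μm : Im → Measure ℝ)
    (μ1p : Ip → Measure ℝ) (μ1m : Im → Measure ℝ)
    (X : HS (Sum.elim μp μm) →ₗ.[ℂ] HS (Sum.elim μp μm))
    (V W : HS (fun j => wd (μ1m j)) ≃ₗᵢ[ℂ] HS (fun j => wd (μ1p j)))
    (f : HS (Sum.elim μp μm)) : Prop :=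
  ∃ (be bo : HS (fun j => wd (μ1p j))) (ce co : HS (fun j => wd (μ1m j))),
    IsBdry q μp μm μ1p μ1m X f be bo ce co ∧
    be + bo = V (ce + co) ∧ be - bo = W (ce - co)

/-- The bounded operator `A` commutes with the (possibly unbounded) operator `T`,
i.e. `T A ⊆ A T`. -/
def CommutesPMap {H : Type*} [NormedAddCommGroup H] [InnerProductSpace ℂ H]
    (A : H →L[ℂ] H) (T : H →ₗ.[ℂ] H) : Prop :=
  ∀ f : T.domain, ∃ h : A f ∈ T.domain, T ⟨A f, h⟩ = A (T f)

/-- `Θ T Θ* = T'` for a unitary `Θ` and (possibly unbounded) operators `T`, `T'`. -/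
def TransportsPMap {H H' : Type*} [NormedAddCommGroup H] [InnerProductSpace ℂ H]
    [NormedAddCommGroup H'] [InnerProductSpace ℂ H']
    (Θ : H ≃ₗᵢ[ℂ] H') (T : H →ₗ.[ℂ] H) (T' : H' →ₗ.[ℂ] H') : Prop :=
  (∀ f : T.domain, ∃ h : Θ f ∈ T'.domain, T' ⟨Θ f, h⟩ = Θ (T f)) ∧
  (∀ g : T'.domain, Θ.symm g ∈ T.domain)

/-- `A n` restricts a vector to the `n`-th rung of a self-similar ladder with ratio `r ^ 2`,
`E n` is its adjoint, `M` is the common (invertible) profile of `A n ∘ E n`, with inverse `N`,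
and `σ` is a symmetry commuting with `M`. -/
structure IsLadder {H K : Type*} [NormedAddCommGroup H] [InnerProductSpace ℂ H]
    [NormedAddCommGroup K] [InnerProductSpace ℂ K] (r : ℝ)
    (A : ℤ → H →L[ℂ] K) (E : ℤ → K →L[ℂ] H) (M N σ : K →L[ℂ] K) : Prop where
  r_pos : 0 < r
  r_lt_one : r < 1
  adj : ∀ n k f, inner ℂ (E n k) f = inner ℂ k (A n f)
  diag : ∀ n k, A n (E n k) = (r : ℂ) ^ (-(2 * n)) • M k
  off : ∀ m n k, m ≠ n → A m (E n k) = 0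
  inj : ∀ f, (∀ n, A n f = 0) → f = 0
  M_N : ∀ k, M (N k) = k
  N_M : ∀ k, N (M k) = k
  σ_σ : ∀ k, σ (σ k) = k
  σ_M : ∀ k, σ (M k) = M (σ k)
  σ_symm : ∀ x y, inner ℂ (σ x) y = inner ℂ x (σ y)

/-- `X` acts on rungs as a signed, scaled second-order difference operator, and its domain consists
of the vectors that stay in the space after division by the ladder variable. -/
structure IsLadderDiff {H K : Type*} [NormedAddCommGroup H] [InnerProductSpace ℂ H]
    [NormedAddCommGroup K] [InnerProductSpace ℂ K] (r : ℝ)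
    (A : ℤ → H →L[ℂ] K) (M σ : K →L[ℂ] K) (X : H →ₗ.[ℂ] H) : Prop where
  dom : ∀ f, f ∈ X.domain ↔ ∃ g, ∀ n, A n g = (r : ℂ) ^ (-(2 * n)) • σ (M (A n f))
  op : ∀ (f : X.domain) (n : ℤ), A n (X f) =
    (Complex.I * (r : ℂ) ^ (-(2 * n))) • σ (M (A (n - 1) (f : H) - A (n + 1) (f : H)))

namespace IsLadder

variable {H K : Type*} [NormedAddCommGroup H] [InnerProductSpace ℂ H]
  [NormedAddCommGroup K] [InnerProductSpace ℂ K] {r : ℝ}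
  {A : ℤ → H →L[ℂ] K} {E : ℤ → K →L[ℂ] H} {M N σ : K →L[ℂ] K}

theorem rc_ne (h : IsLadder r A E M N σ) : (r : ℂ) ≠ 0 := by
  exact_mod_cast h.r_pos.ne'

theorem ext (h : IsLadder r A E M N σ) {f g : H} (hfg : ∀ n, A n f = A n g) : f = g := by
  rw [← sub_eq_zero]
  exact h.inj _ fun n => by rw [map_sub, hfg, sub_self]

theorem M_symm (h : IsLadder r A E M N σ) (x y : K) : inner ℂ (M x) y = inner ℂ x (M y) := by
  have e : ∀ k, M k = A 0 (E 0 k) := fun k => by simp [h.diag]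
  rw [e, e, ← h.adj, ← inner_conj_symm, ← h.adj, inner_conj_symm]

theorem norm_E_le (h : IsLadder r A E M N σ) (n : ℤ) (k : K) :
    ‖E n k‖ ≤ (1 + ‖M‖) * r ^ (-n) * ‖k‖ := by
  have hr := h.r_pos
  have h1 : ‖E n k‖ ^ 2 ≤ r ^ (-(2 * n)) * (‖M‖ * ‖k‖ ^ 2) := by
    have h2 : ((‖E n k‖ : ℂ)) ^ 2 = (r : ℂ) ^ (-(2 * n)) * inner ℂ k (M k) := by
      have := inner_self_eq_norm_sq_to_K (𝕜 := ℂ) (E n k)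
      rw [h.adj, h.diag, inner_smul_right] at this
      exact this.symm
    have h3 : ‖E n k‖ ^ 2 = r ^ (-(2 * n)) * ‖inner ℂ k (M k)‖ := by
      have := congrArg norm h2
      simpa [abs_of_pos hr] using this
    rw [h3]
    gcongr
    calc ‖inner ℂ k (M k)‖ ≤ ‖k‖ * ‖M k‖ := norm_inner_le_norm _ _
      _ ≤ ‖k‖ * (‖M‖ * ‖k‖) := by gcongr; exact M.le_opNorm k
      _ = _ := by ring
  refine le_of_sq_le_sq (h1.trans ?_) (by positivity)
  have e : r ^ (-(2 * n)) = (r ^ (-n)) ^ 2 := by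
    rw [← zpow_natCast, ← zpow_mul]; congr 1; push_cast; ring
  rw [e, mul_pow, mul_pow]
  have : ‖M‖ ≤ (1 + ‖M‖) ^ 2 := by nlinarith [norm_nonneg M]
  calc (r ^ (-n)) ^ 2 * (‖M‖ * ‖k‖ ^ 2) ≤ (r ^ (-n)) ^ 2 * ((1 + ‖M‖) ^ 2 * ‖k‖ ^ 2) := by gcongr
    _ = _ := by ring

theorem norm_A_le (h : IsLadder r A E M N σ) (n : ℤ) (f : H) :
    ‖A n f‖ ≤ (1 + ‖M‖) * r ^ (-n) * ‖f‖ := by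
  have hr := h.r_pos
  rcases eq_or_ne (A n f) 0 with h0 | h0
  · rw [h0, norm_zero]; positivity
  have h1 : ‖A n f‖ * ‖A n f‖ = ‖inner ℂ (E n (A n f)) f‖ := by
    rw [h.adj, inner_self_eq_norm_sq_to_K]; simp [sq]
  have h2 : ‖A n f‖ * ‖A n f‖ ≤ ‖A n f‖ * ((1 + ‖M‖) * r ^ (-n) * ‖f‖) := by
    rw [h1]
    refine (norm_inner_le_norm _ _).trans ?_
    calc _ ≤ (1 + ‖M‖) * r ^ (-n) * ‖A n f‖ * ‖f‖ := by gcongr; exact h.norm_E_le n _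
      _ = _ := by ring
  exact le_of_mul_le_mul_left h2 (norm_pos_iff.mpr h0)

theorem E_mem_domain (h : IsLadder r A E M N σ) {X : H →ₗ.[ℂ] H}
    (hX : IsLadderDiff r A M σ X) (n : ℤ) (k : K) :
    E n k ∈ X.domain := by
  refine (hX.dom _).2 ⟨E n ((r : ℂ) ^ (-(2 * n)) • σ (M k)), fun m => ?_⟩
  rcases eq_or_ne m n with rfl | hm
  · simp [h.diag, h.σ_M]
  · simp [h.off _ _ _ hm]

theorem X_E {X : H →ₗ.[ℂ] H} (h : IsLadder r A E M N σ)
    (hX : IsLadderDiff r A M σ X) (n : ℤ) (k : K) :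
    X ⟨E n k, h.E_mem_domain hX n k⟩ =
      (Complex.I * (r : ℂ) ^ (-(2 * n))) • (E (n + 1) (σ (M k)) - E (n - 1) (σ (M k))) := by
  have hr := h.rc_ne
  refine h.ext fun m => ?_
  rw [hX.op]
  by_cases h1 : m = n + 1
  · subst h1
    simp only [add_sub_cancel_right, h.diag, h.off (n + 1 + 1) n _ (by omega),
      h.off (n + 1) (n - 1) _ (by omega), sub_zero, map_sub, map_smul, smul_smul, h.σ_M]
    congr 1; ring
  by_cases h2 : m = n - 1
  · subst h2
    simp only [sub_add_cancel, h.diag, h.off (n - 1 - 1) n _ (by omega),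
      h.off (n - 1) (n + 1) _ (by omega), zero_sub, map_sub, map_smul, map_neg, smul_neg,
      smul_smul, h.σ_M]
    congr 2; ring
  · simp [h.off (m - 1) n _ (by omega), h.off (m + 1) n _ (by omega), h.off m (n + 1) _ h1,
      h.off m (n - 1) _ h2]

/-- A rung-wise prescribed vector exists if the prescribed values decay fast enough. -/
theorem exists_of_summable [CompleteSpace H] (h : IsLadder r A E M N σ) {ι : ℕ → ℤ}
    (hι : Function.Injective ι) (a : ℕ → K) (ha : Summable fun k => r ^ ι k * ‖a k‖) :
    ∃ f, HasSum (fun k => E (ι k) ((r : ℂ) ^ (2 * ι k) • N (a k))) f ∧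
      (∀ k, A (ι k) f = a k) ∧ ∀ n, (∀ k, n ≠ ι k) → A n f = 0 := by
  have hr := h.r_pos
  have hs : Summable fun k => E (ι k) ((r : ℂ) ^ (2 * ι k) • N (a k)) := by
    refine Summable.of_norm_bounded (ha.mul_left ((1 + ‖M‖) * ‖N‖)) fun k => ?_
    refine (h.norm_E_le _ _).trans ?_
    rw [norm_smul]
    have e : ‖(r : ℂ) ^ (2 * ι k)‖ = r ^ ι k * r ^ ι k := by
      rw [norm_zpow, Complex.norm_real, Real.norm_of_nonneg hr.le, ← zpow_add₀ hr.ne', two_mul]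
    have e2 : r ^ (-ι k) * r ^ ι k = 1 := by
      rw [← zpow_add₀ hr.ne']; simp
    calc (1 + ‖M‖) * r ^ (-ι k) * (‖(r : ℂ) ^ (2 * ι k)‖ * ‖N (a k)‖)
        = (r ^ (-ι k) * r ^ ι k) * ((1 + ‖M‖) * r ^ ι k * ‖N (a k)‖) := by rw [e]; ring
      _ = (1 + ‖M‖) * r ^ ι k * ‖N (a k)‖ := by rw [e2, one_mul]
      _ ≤ (1 + ‖M‖) * r ^ ι k * (‖N‖ * ‖a k‖) := by gcongr; exact N.le_opNorm _
      _ = _ := by ring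
  refine ⟨_, hs.hasSum, fun k => ?_, fun n hn => ?_⟩
  · have h1 := (A (ι k)).hasSum hs.hasSum
    refine h1.unique ?_
    convert hasSum_single k fun m hm => ?_ using 1
    · rw [h.diag, map_smul, h.M_N, smul_smul, ← zpow_add₀ h.rc_ne]; simp
    · exact h.off _ _ _ fun e => hm (hι e.symm)
  · have h1 := (A n).hasSum hs.hasSum
    refine h1.unique ?_
    convert hasSum_zero using 2 with k
    exact h.off _ _ _ (hn k)

theorem exists_truncation [CompleteSpace H] (h : IsLadder r A E M N σ) (f : H) :
    ∃ g, (∀ n, 0 ≤ n → A n g = A n f) ∧ ∀ n, n < 0 → A n g = 0 := by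
  let S : Submodule ℂ H := ⨅ n : {n : ℤ // n < 0}, LinearMap.ker (A n.1).toLinearMap
  have hS : IsClosed (S : Set H) := by
    simp only [S, Submodule.coe_iInf]
    exact isClosed_iInter fun n => (A n.1).isClosed_ker
  have : CompleteSpace S := hS.completeSpace_coe
  have hmem : ∀ x, x ∈ S ↔ ∀ n : ℤ, n < 0 → A n x = 0 := fun x => by
    simp [S, Submodule.mem_iInf]
  obtain ⟨y, hy, z, hz, e⟩ := S.exists_add_mem_mem_orthogonal f
  refine ⟨y, fun n hn => ?_, (hmem y).1 hy⟩
  have : A n z = 0 := by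
    refine ext_inner_left ℂ fun k => ?_
    rw [← h.adj, inner_zero_right]
    exact hz _ ((hmem _).2 fun m hm => h.off _ _ _ (by omega))
  rw [e, map_add, this, add_zero]

/-- The vector equal to `k` on the rungs `p, p + 2, p + 4, …`. -/
theorem exists_tail [CompleteSpace H] (h : IsLadder r A E M N σ) (p : ℤ) (k : K) :
    ∃ f, HasSum (fun m : ℕ => E (2 * m + p) ((r : ℂ) ^ (2 * (2 * m + p)) • N k)) f ∧
      (∀ m : ℕ, A (2 * m + p) f = k) ∧ ∀ n, (∀ m : ℕ, n ≠ 2 * m + p) → A n f = 0 := by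
  refine h.exists_of_summable (ι := fun m : ℕ => 2 * m + p) (fun a b e => by
    simp only at e; omega) (fun _ => k) ?_
  have hr := h.r_pos
  have e : (fun m : ℕ => r ^ (2 * (m : ℤ) + p) * ‖k‖) = fun m : ℕ => (r ^ 2) ^ m * (r ^ p * ‖k‖) := by
    ext m
    rw [zpow_add₀ hr.ne', zpow_mul]
    push_cast [zpow_natCast]
    norm_cast
    ring
  rw [e]
  exact (summable_geometric_of_lt_one (by positivity)
    (pow_lt_one₀ hr.le h.r_lt_one two_ne_zero)).mul_right _

/-- The vector equal to `k` on the rungs `p, p + 2, p + 4, …`, as a chosen element. -/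
def tail [CompleteSpace H] (h : IsLadder r A E M N σ) (p : ℤ) (k : K) : H :=
  (h.exists_tail p k).choose

section Complete

variable [CompleteSpace H]

theorem hasSum_tail (h : IsLadder r A E M N σ) (p : ℤ) (k : K) :
    HasSum (fun m : ℕ => E (2 * m + p) ((r : ℂ) ^ (2 * (2 * m + p)) • N k)) (h.tail p k) :=
  (h.exists_tail p k).choose_spec.1

theorem A_tail (h : IsLadder r A E M N σ) (p : ℤ) (k : K) (n : ℤ) [Decidable (p ≤ n ∧ Even (n - p))] :
    A n (h.tail p k) = if p ≤ n ∧ Even (n - p) then k else 0 := by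
  split_ifs with hn
  · obtain ⟨m, hm⟩ : ∃ m : ℕ, n = 2 * m + p := by
      obtain ⟨h1, m, hm⟩ := hn
      exact ⟨m.toNat, by omega⟩
    rw [hm]
    exact (h.exists_tail p k).choose_spec.2.1 m
  · refine (h.exists_tail p k).choose_spec.2.2 n fun m hm => hn ⟨by omega, m, by omega⟩

theorem tail_add (h : IsLadder r A E M N σ) (p : ℤ) (k l : K) :
    h.tail p (k + l) = h.tail p k + h.tail p l := by
  classical
  refine h.ext fun n => ?_
  simp only [map_add, h.A_tail]
  split_ifs <;> simp

theorem tail_smul (h : IsLadder r A E M N σ) (p : ℤ) (c : ℂ) (k : K) :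
    h.tail p (c • k) = c • h.tail p k := by
  classical
  refine h.ext fun n => ?_
  simp only [map_smul, h.A_tail]
  split_ifs <;> simp

theorem dense_domain {X : H →ₗ.[ℂ] H} (h : IsLadder r A E M N σ)
    (hX : IsLadderDiff r A M σ X) :
    Dense (X.domain : Set H) := by
  rw [Submodule.dense_iff_topologicalClosure_eq_top, Submodule.topologicalClosure_eq_top_iff,
    Submodule.eq_bot_iff]
  intro f hf
  refine h.inj f fun n => ext_inner_left ℂ fun k => ?_
  rw [← h.adj, inner_zero_right]
  exact hf _ (h.E_mem_domain hX n k)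

theorem A_adjoint {X : H →ₗ.[ℂ] H} (h : IsLadder r A E M N σ)
    (hX : IsLadderDiff r A M σ X)
    (f : X.adjoint.domain) (n : ℤ) : A n (X.adjoint f) =
      (Complex.I * (r : ℂ) ^ (-(2 * n))) • σ (M (A (n - 1) (f : H) - A (n + 1) (f : H))) := by
  refine ext_inner_left ℂ fun k => ?_
  rw [← h.adj, ← inner_conj_symm,
    LinearPMap.adjoint_isFormalAdjoint (h.dense_domain hX) f ⟨E n k, h.E_mem_domain hX n k⟩,
    inner_conj_symm, h.X_E hX, inner_smul_left, inner_sub_left, h.adj, h.adj, h.σ_symm, h.σ_symm,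
    h.M_symm, h.M_symm, inner_smul_right, map_sub, map_sub, inner_sub_right, ← h.σ_M, ← h.σ_M]
  simp only [map_mul, Complex.conj_I, map_zpow₀, Complex.conj_ofReal]
  ring

theorem inner_tail_apply {X : H →ₗ.[ℂ] H} (h : IsLadder r A E M N σ)
    (hX : IsLadderDiff r A M σ X) (p : ℤ) (k : K)
    (φ : X.domain) : inner ℂ (-Complex.I • E (p - 1) (σ k)) (φ : H) =
      inner ℂ (h.tail p k) (X φ) := by
  have hr := h.r_pos
  obtain ⟨g, hg⟩ := (hX.dom φ).1 φ.2
  have hA : ∀ n, A n (φ : H) = (r : ℂ) ^ (2 * n) • N (σ (A n g)) := fun n => by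
    rw [hg, map_smul, map_smul, smul_smul, h.σ_σ, h.N_M, ← zpow_add₀ h.rc_ne]; simp
  have hlim : Filter.Tendsto (fun m : ℕ => inner ℂ (σ k) (A (2 * m + p - 1) (φ : H)))
      Filter.atTop (nhds 0) := by
    have h0 : Filter.Tendsto (fun m : ℕ => A (2 * m + p - 1) (φ : H)) Filter.atTop (nhds 0) := by
      have hb : ∀ m : ℕ, ‖A (2 * m + p - 1) (φ : H)‖ ≤
          (‖N‖ * (‖σ‖ * ((1 + ‖M‖) * ‖g‖)) * r ^ (p - 1)) * (r ^ 2) ^ m := fun m => by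
        set n : ℤ := 2 * m + p - 1 with hn
        have e1 : r ^ (2 * n) * r ^ (-n) = r ^ (p - 1) * (r ^ 2) ^ m := by
          rw [← zpow_add₀ hr.ne', ← pow_mul, ← zpow_natCast, ← zpow_add₀ hr.ne']
          congr 1; push_cast; omega
        rw [hA, norm_smul, norm_zpow, Complex.norm_real, Real.norm_of_nonneg hr.le]
        calc r ^ (2 * n) * ‖N (σ (A n g))‖
            ≤ r ^ (2 * n) * (‖N‖ * (‖σ‖ * ((1 + ‖M‖) * r ^ (-n) * ‖g‖))) := by
              gcongr
              refine (N.le_opNorm _).trans ?_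
              gcongr
              refine (σ.le_opNorm _).trans ?_
              gcongr
              exact h.norm_A_le _ _
          _ = (‖N‖ * (‖σ‖ * ((1 + ‖M‖) * ‖g‖))) * (r ^ (2 * n) * r ^ (-n)) := by ring
          _ = _ := by rw [e1]; ring
      refine squeeze_zero_norm hb ?_
      have := (tendsto_pow_atTop_nhds_zero_of_lt_one (by positivity : 0 ≤ r ^ 2)
        (pow_lt_one₀ hr.le h.r_lt_one two_ne_zero)).const_mul
          (‖N‖ * (‖σ‖ * ((1 + ‖M‖) * ‖g‖)) * r ^ (p - 1))
      simpa using this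
    have := (Filter.Tendsto.inner (𝕜 := ℂ) (tendsto_const_nhds (x := σ k)) h0)
    simpa using this
  have hsum : HasSum (fun m : ℕ => Complex.I * (inner ℂ (σ k) (A (2 * m + p - 1) (φ : H)) -
      inner ℂ (σ k) (A (2 * (m + 1 : ℕ) + p - 1) (φ : H)))) (inner ℂ (h.tail p k) (X φ)) := by
    have h1 := (innerSLFlip ℂ (X φ)).hasSum (h.hasSum_tail p k)
    simp only [innerSLFlip_apply_apply] at h1
    refine (congrArg (HasSum · _) (funext fun m => ?_)).mp h1
    rw [h.adj, hX.op, inner_smul_left, inner_smul_right, h.σ_M, ← h.M_symm, h.M_N, ← h.σ_symm,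
      inner_sub_right]
    have e : (r : ℂ) ^ (2 * (2 * (m : ℤ) + p)) * (r : ℂ) ^ (-(2 * (2 * (m : ℤ) + p))) = 1 := by
      rw [← zpow_add₀ h.rc_ne]; simp
    have e' : (2 * ((m + 1 : ℕ) : ℤ) + p - 1) = 2 * m + p + 1 := by push_cast; ring
    rw [e']
    simp only [map_zpow₀, Complex.conj_ofReal]
    linear_combination (Complex.I * (inner ℂ (σ k) (A (2 * m + p - 1) (φ : H)) -
      inner ℂ (σ k) (A (2 * m + p + 1) (φ : H)))) * e
  have h2 := hsum.tendsto_sum_nat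
  have h3 : ∀ n : ℕ, ∑ m ∈ Finset.range n, Complex.I *
      (inner ℂ (σ k) (A (2 * m + p - 1) (φ : H)) -
        inner ℂ (σ k) (A (2 * (m + 1 : ℕ) + p - 1) (φ : H))) =
      Complex.I * (inner ℂ (σ k) (A (p - 1) (φ : H)) -
        inner ℂ (σ k) (A (2 * n + p - 1) (φ : H))) := fun n => by
    rw [← Finset.mul_sum, Finset.sum_range_sub'
      (fun m : ℕ => inner ℂ (σ k) (A (2 * m + p - 1) (φ : H)))]
    simp
  simp only [h3] at h2
  have h4 := (hlim.const_sub (inner ℂ (σ k) (A (p - 1) (φ : H)))).const_mul Complex.I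
  rw [tendsto_nhds_unique h2 h4, inner_smul_left, h.adj]
  simp

/-- Every vector in the domain of the adjoint is the sum of a vector in the domain and of two
tails. -/
theorem exists_decomposition {X : H →ₗ.[ℂ] H} (h : IsLadder r A E M N σ)
    (hX : IsLadderDiff r A M σ X) {U : H →L[ℂ] H} (hU : ∀ n f, A n (U f) = (r : ℂ) • A (n + 1) f)
    (hU1 : ‖U‖ ≤ 1) {f : H} (hf : f ∈ X.adjoint.domain) :
    ∃ fX ∈ X.domain, ∃ a b : K, f = fX + (h.tail 0 a + h.tail 1 b) := by
  classical
  have hr := h.r_pos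
  have hrc := h.rc_ne
  set g := X.adjoint ⟨f, hf⟩ with hg
  obtain ⟨g', hg'⟩ : ∃ g', g' - ((r : ℂ) ^ 2) • U (U g') = (-Complex.I * r) • U g := by
    have hn : ‖((r : ℂ) ^ 2) • (U * U)‖ < 1 := by
      rw [norm_smul, norm_pow, Complex.norm_real, Real.norm_of_nonneg hr.le]
      have h1 : ‖U * U‖ ≤ 1 := (norm_mul_le _ _).trans (by nlinarith [norm_nonneg U])
      have h2 : r ^ 2 < 1 := pow_lt_one₀ hr.le h.r_lt_one two_ne_zero
      nlinarith [norm_nonneg (U * U)]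
    obtain ⟨u, hu⟩ := isUnit_one_sub_of_norm_lt_one hn
    refine ⟨(↑u⁻¹ : H →L[ℂ] H) ((-Complex.I * r) • U g), ?_⟩
    have := congrArg (fun T : H →L[ℂ] H => T ((-Complex.I * r) • U g)) u.mul_inv
    rw [hu] at this
    simpa using this
  have hstep : ∀ m, A m g' - (r : ℂ) ^ 4 • A (m + 2) g' =
      (-Complex.I * r ^ 2) • A (m + 1) g := fun m => by
    have := congrArg (A m) hg'
    rw [map_sub, map_smul, map_smul, hU, hU, hU, smul_smul, smul_smul, smul_smul] at this
    rw [show m + 1 + 1 = m + 2 by ring] at this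
    rw [show (r : ℂ) ^ 4 = r ^ 2 * r * r by ring,
      show -Complex.I * (r : ℂ) ^ 2 = -Complex.I * r * r by ring]
    exact this
  obtain ⟨u, -, hu0, hu1⟩ := h.exists_of_summable (ι := fun k : ℕ => (k : ℤ)) Nat.cast_injective
    (fun k => (r : ℂ) ^ (2 * (k : ℤ)) • N (σ (A k g'))) (by
      refine Summable.of_nonneg_of_le (fun k => by positivity) (fun k => ?_)
        ((summable_geometric_of_lt_one (by positivity) (pow_lt_one₀ hr.le h.r_lt_one
          two_ne_zero : r ^ 2 < 1)).mul_left (‖N‖ * (‖σ‖ * ((1 + ‖M‖) * ‖g'‖))))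
      rw [norm_smul, norm_zpow, Complex.norm_real, Real.norm_of_nonneg hr.le]
      have e : r ^ (k : ℤ) * r ^ (2 * (k : ℤ)) * r ^ (-(k : ℤ)) = (r ^ 2) ^ k := by
        rw [← zpow_add₀ hr.ne', ← zpow_add₀ hr.ne', ← pow_mul, ← zpow_natCast]
        congr 1; push_cast; ring
      calc r ^ (k : ℤ) * (r ^ (2 * (k : ℤ)) * ‖N (σ (A k g'))‖)
          ≤ r ^ (k : ℤ) * (r ^ (2 * (k : ℤ)) *
            (‖N‖ * (‖σ‖ * ((1 + ‖M‖) * r ^ (-(k : ℤ)) * ‖g'‖)))) := by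
            gcongr
            refine (N.le_opNorm _).trans ?_
            gcongr
            refine (σ.le_opNorm _).trans ?_
            gcongr
            exact h.norm_A_le _ _
        _ = (‖N‖ * (‖σ‖ * ((1 + ‖M‖) * ‖g'‖))) *
            (r ^ (k : ℤ) * r ^ (2 * (k : ℤ)) * r ^ (-(k : ℤ))) := by ring
        _ = _ := by rw [e])
  obtain ⟨w, -, hw0, hw1⟩ := h.exists_of_summable (ι := fun k : ℕ => -((k : ℤ) + 1))
    (fun a b e => by simp only at e; omega)
    (fun k => (r : ℂ) ^ (2 * ((k : ℤ) + 1)) • σ (M (A (-((k : ℤ) + 1)) f))) (by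
      refine Summable.of_nonneg_of_le (fun k => by positivity) (fun k => ?_)
        ((summable_geometric_of_lt_one (by positivity) (pow_lt_one₀ hr.le h.r_lt_one
          two_ne_zero : r ^ 2 < 1)).mul_left (‖σ‖ * (‖M‖ * ((1 + ‖M‖) * ‖f‖)) * r ^ 2))
      rw [norm_smul, norm_zpow, Complex.norm_real, Real.norm_of_nonneg hr.le]
      have e : r ^ (-((k : ℤ) + 1)) * r ^ (2 * ((k : ℤ) + 1)) * r ^ (- -((k : ℤ) + 1)) =
          r ^ 2 * (r ^ 2) ^ k := by
        rw [← zpow_add₀ hr.ne', ← zpow_add₀ hr.ne', ← pow_succ', ← pow_mul, ← zpow_natCast]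
        congr 1; push_cast; ring
      calc r ^ (-((k : ℤ) + 1)) * (r ^ (2 * ((k : ℤ) + 1)) * ‖σ (M (A (-((k : ℤ) + 1)) f))‖)
          ≤ r ^ (-((k : ℤ) + 1)) * (r ^ (2 * ((k : ℤ) + 1)) *
            (‖σ‖ * (‖M‖ * ((1 + ‖M‖) * r ^ (- -((k : ℤ) + 1)) * ‖f‖)))) := by
            gcongr
            refine (σ.le_opNorm _).trans ?_
            gcongr
            refine (M.le_opNorm _).trans ?_
            gcongr
            exact h.norm_A_le _ _
        _ = (‖σ‖ * (‖M‖ * ((1 + ‖M‖) * ‖f‖))) *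
            (r ^ (-((k : ℤ) + 1)) * r ^ (2 * ((k : ℤ) + 1)) * r ^ (- -((k : ℤ) + 1))) := by ring
        _ = _ := by rw [e]; ring)
  obtain ⟨f₁, hf₁, hf₁'⟩ := h.exists_truncation f
  obtain ⟨g₁, hg₁, hg₁'⟩ := h.exists_truncation g'
  have hu : ∀ n : ℤ, 0 ≤ n → A n u = (r : ℂ) ^ (2 * n) • N (σ (A n g')) := fun n hn => by
    lift n to ℕ using hn
    exact hu0 n
  have hu' : ∀ n : ℤ, n < 0 → A n u = 0 := fun n hn => hu1 n fun k => by omega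
  have hw : ∀ n : ℤ, n < 0 → A n w = (r : ℂ) ^ (-(2 * n)) • σ (M (A n f)) := fun n hn => by
    obtain ⟨k, rfl⟩ : ∃ k : ℕ, n = -((k : ℤ) + 1) := ⟨(-n - 1).toNat, by omega⟩
    rw [hw0, show 2 * ((k : ℤ) + 1) = -(2 * -((k : ℤ) + 1)) by ring]
  have hw' : ∀ n : ℤ, 0 ≤ n → A n w = 0 := fun n hn => hw1 n fun k => by omega
  have hx : ∀ n : ℤ, 0 ≤ n → A n (u + (f - f₁)) = (r : ℂ) ^ (2 * n) • N (σ (A n g')) :=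
    fun n hn => by rw [map_add, map_sub, hf₁ n hn, hu n hn, sub_self, add_zero]
  have hx' : ∀ n : ℤ, n < 0 → A n (u + (f - f₁)) = A n f := fun n hn => by
    rw [map_add, map_sub, hf₁' n hn, hu' n hn, sub_zero, zero_add]
  have hper : ∀ n : ℤ, 0 ≤ n →
      A (n + 2) (f - (u + (f - f₁))) = A n (f - (u + (f - f₁))) := fun n hn => by
    have h1 := h.A_adjoint hX ⟨f, hf⟩ (n + 1)
    rw [← hg] at h1
    simp only [add_sub_cancel_right, show n + 1 + 1 = n + 2 by ring] at h1
    have h2 : A n f - A (n + 2) f = (-Complex.I * (r : ℂ) ^ (2 * (n + 1))) • N (σ (A (n + 1) g)) := by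
      rw [h1, map_smul, map_smul, h.σ_σ, h.N_M, smul_smul]
      have e : (r : ℂ) ^ (2 * (n + 1)) * (r : ℂ) ^ (-(2 * (n + 1))) = 1 := by
        rw [← zpow_add₀ hrc]; simp
      have e' : (-Complex.I * (r : ℂ) ^ (2 * (n + 1))) * (Complex.I * (r : ℂ) ^ (-(2 * (n + 1)))) = 1 := by
        linear_combination e - (r : ℂ) ^ (2 * (n + 1)) * (r : ℂ) ^ (-(2 * (n + 1))) * Complex.I_sq
      rw [e', one_smul]
    have h3 : (r : ℂ) ^ (2 * n) • N (σ (A n g')) - (r : ℂ) ^ (2 * (n + 2)) • N (σ (A (n + 2) g')) =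
        (-Complex.I * (r : ℂ) ^ (2 * (n + 1))) • N (σ (A (n + 1) g)) := by
      have := congrArg (fun x => (r : ℂ) ^ (2 * n) • N (σ x)) (hstep n)
      simp only [map_sub, map_smul, smul_sub, smul_smul] at this
      have e1 : (r : ℂ) ^ (2 * (n + 2)) = (r : ℂ) ^ (2 * n) * (r : ℂ) ^ 4 := by
        rw [mul_add, zpow_add₀ hrc]; norm_cast
      have e2 : (r : ℂ) ^ (2 * (n + 1)) = (r : ℂ) ^ (2 * n) * (r : ℂ) ^ 2 := by
        rw [mul_add, zpow_add₀ hrc]; norm_cast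
      rw [e1, e2, this]
      congr 1; ring
    rw [map_sub, map_sub, hx n hn, hx (n + 2) (by omega), sub_eq_sub_iff_sub_eq_sub,
      ← neg_sub (A n f), h2, ← h3, neg_sub]
  have hper' : ∀ (m : ℕ) (p : ℤ), 0 ≤ p →
      A (2 * m + p) (f - (u + (f - f₁))) = A p (f - (u + (f - f₁))) := fun m p hp => by
    induction m with
    | zero => simp
    | succ m ih =>
      rw [← ih, ← hper (2 * m + p) (by positivity),
        show 2 * ((m + 1 : ℕ) : ℤ) + p = 2 * m + p + 2 by push_cast; ring]
  refine ⟨u + (f - f₁), (hX.dom _).2 ⟨g₁ + w, fun n => ?_⟩, A 0 (f - (u + (f - f₁))),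
    A 1 (f - (u + (f - f₁))), ?_⟩
  · rcases lt_or_ge n 0 with hn | hn
    · rw [hx' n hn, map_add, hw n hn, hg₁' n hn, zero_add]
    · rw [hx n hn, map_add, hw' n hn, hg₁ n hn, add_zero, map_smul, map_smul, h.M_N, h.σ_σ,
        smul_smul, ← zpow_add₀ hrc]
      simp
  · rw [← sub_eq_iff_eq_add']
    refine h.ext fun n => ?_
    rw [map_add, h.A_tail, h.A_tail]
    rcases lt_or_ge n 0 with hn | hn
    · rw [map_sub, hx' n hn, if_neg (by omega), if_neg (by omega)]; simp
    · rcases Int.even_or_odd' n with ⟨m, rfl | rfl⟩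
      · lift m to ℕ using by omega
        rw [if_pos ⟨hn, by simp⟩, if_neg (by rintro ⟨-, c, hc⟩; omega), add_zero]
        simpa using hper' m 0 le_rfl
      · lift m to ℕ using by omega
        rw [if_neg (by rintro ⟨-, c, hc⟩; omega), if_pos ⟨by omega, by simp⟩, zero_add]
        exact hper' m 1 zero_le_one

theorem U_tail_one (h : IsLadder r A E M N σ) {U : H →L[ℂ] H}
    (hU : ∀ n f, A n (U f) = (r : ℂ) • A (n + 1) f) (k : K) :
    U (h.tail 1 k) = (r : ℂ) • h.tail 0 k := by
  classical
  refine h.ext fun n => ?_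
  rw [hU, map_smul, h.A_tail, h.A_tail, add_sub_cancel_right, sub_zero]
  congr 2
  simp

theorem U_tail_zero (h : IsLadder r A E M N σ) {U : H →L[ℂ] H}
    (hU : ∀ n f, A n (U f) = (r : ℂ) • A (n + 1) f) (k : K) :
    U (h.tail 0 k) = (r : ℂ) • (E (-1) ((r : ℂ) ^ (-2 : ℤ) • N k) + h.tail 1 k) := by
  classical
  have hr := h.rc_ne
  refine h.ext fun n => ?_
  rw [hU, map_smul, map_add, h.A_tail, h.A_tail]
  congr 1
  rcases eq_or_ne n (-1) with rfl | hn
  · rw [h.diag, map_smul, h.M_N, smul_smul, ← zpow_add₀ hr]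
    simp
  · rw [h.off _ _ _ hn, zero_add]
    refine if_congr ⟨fun ⟨h1, c, hc⟩ => ⟨by omega, c - 1, by omega⟩,
      fun ⟨h1, c, hc⟩ => ⟨by omega, c + 1, by omega⟩⟩ rfl rfl

/-- The pair of tails with values `a` on even and `b` on odd nonnegative rungs, linearly. -/
def tails (h : IsLadder r A E M N σ) : K × K →ₗ[ℂ] H where
  toFun z := h.tail 0 z.1 + h.tail 1 z.2
  map_add' z w := by simp only [Prod.fst_add, Prod.snd_add, h.tail_add]; abel
  map_smul' c z := by simp only [Prod.smul_fst, Prod.smul_snd, h.tail_smul, smul_add,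
    RingHom.id_apply]

theorem tails_apply (h : IsLadder r A E M N σ) (a b : K) :
    h.tails (a, b) = h.tail 0 a + h.tail 1 b := rfl

theorem inner_E_tails (h : IsLadder r A E M N σ) (a b a' b' : K) :
    inner ℂ (-Complex.I • (E (-1) (σ a) + E 0 (σ b))) (h.tails (a', b')) =
      Complex.I * inner ℂ (σ b) a' := by
  classical
  rw [inner_smul_left, inner_add_left, h.adj, h.adj, tails_apply, map_add, map_add, h.A_tail,
    h.A_tail, h.A_tail, h.A_tail]
  simp

theorem inner_tails_apply {X : H →ₗ.[ℂ] H} (h : IsLadder r A E M N σ)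
    (hX : IsLadderDiff r A M σ X) (a b : K) (φ : X.domain) :
    inner ℂ (-Complex.I • (E (-1) (σ a) + E 0 (σ b))) (φ : H) =
      inner ℂ (h.tails (a, b)) (X φ) := by
  rw [tails_apply, inner_add_left, ← h.inner_tail_apply hX, ← h.inner_tail_apply hX, smul_add,
    inner_add_left]
  simp

theorem adjoint_tails {X : H →ₗ.[ℂ] H} (h : IsLadder r A E M N σ)
    (hX : IsLadderDiff r A M σ X) (a b : K) (hab : h.tails (a, b) ∈ X.adjoint.domain) :
    X.adjoint ⟨h.tails (a, b), hab⟩ = -Complex.I • (E (-1) (σ a) + E 0 (σ b)) :=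
  LinearPMap.adjoint_apply_eq (h.dense_domain hX) _ (h.inner_tails_apply hX a b)

theorem le_adjoint_of_isSelfAdjoint {X Y : H →ₗ.[ℂ] H} (h : IsLadder r A E M N σ)
    (hX : IsLadderDiff r A M σ X) (hXY : X ≤ Y) (hY : IsSelfAdjoint Y) : Y ≤ X.adjoint := by
  have hf := LinearPMap.adjoint_isFormalAdjoint hY.dense_domain
  rw [LinearPMap.isSelfAdjoint_def.1 hY] at hf
  refine LinearPMap.IsFormalAdjoint.le_adjoint (h.dense_domain hX) fun x y => ?_
  rw [hXY.2 (y := ⟨x, hXY.1 x.2⟩) rfl]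
  exact hf _ _

/-- The boundary space of a self-adjoint extension is Lagrangian. -/
theorem tails_mem_iff {X Y : H →ₗ.[ℂ] H} (h : IsLadder r A E M N σ)
    (hX : IsLadderDiff r A M σ X) {U : H →L[ℂ] H} (hU : ∀ n f, A n (U f) = (r : ℂ) • A (n + 1) f)
    (hU1 : ‖U‖ ≤ 1) (hXY : X ≤ Y) (hY : IsSelfAdjoint Y) (a b : K) :
    h.tails (a, b) ∈ Y.domain ↔ ∀ a' b', h.tails (a', b') ∈ Y.domain →
      inner ℂ (σ b) a' + inner ℂ (σ a) b' = 0 := by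
  have hYX := h.le_adjoint_of_isSelfAdjoint hX hXY hY
  have hYt : ∀ a b (hab : h.tails (a, b) ∈ Y.domain),
      Y ⟨h.tails (a, b), hab⟩ = -Complex.I • (E (-1) (σ a) + E 0 (σ b)) := fun a b hab => by
    rw [hYX.2 (y := ⟨_, hYX.1 hab⟩) rfl, h.adjoint_tails hX]
  have hflip : ∀ a b a' b' : K, inner ℂ (h.tails (a, b))
      (-Complex.I • (E (-1) (σ a') + E 0 (σ b'))) = -Complex.I * inner ℂ (σ a) b' :=
    fun a b a' b' => by
      rw [← inner_conj_symm, h.inner_E_tails, map_mul, inner_conj_symm, h.σ_symm, Complex.conj_I]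
  constructor
  · intro hab a' b' hab'
    have hf := LinearPMap.adjoint_isFormalAdjoint hY.dense_domain
    rw [LinearPMap.isSelfAdjoint_def.1 hY] at hf
    have := hf ⟨_, hab⟩ ⟨_, hab'⟩
    rw [hYt, hYt, h.inner_E_tails, hflip] at this
    refine mul_left_cancel₀ Complex.I_ne_zero ?_
    linear_combination this
  · intro hab
    rw [← LinearPMap.isSelfAdjoint_def.1 hY]
    refine LinearPMap.mem_adjoint_domain_of_exists _
      ⟨-Complex.I • (E (-1) (σ a) + E 0 (σ b)), fun ⟨φ, hφ⟩ => ?_⟩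
    obtain ⟨φX, hφX, a', b', e⟩ := h.exists_decomposition hX hU hU1 (hYX.1 hφ)
    have hφY : φX ∈ Y.domain := hXY.1 hφX
    have hT : h.tails (a', b') ∈ Y.domain := by
      rw [show h.tails (a', b') = φ - φX by rw [e, tails_apply]; abel]
      exact sub_mem hφ hφY
    have e' : (⟨φ, hφ⟩ : Y.domain) = ⟨φX, hφY⟩ + ⟨_, hT⟩ := Subtype.ext e
    rw [e', LinearPMap.map_add, hYt, inner_add_right, hflip, ← hXY.2 (x := ⟨φX, hφX⟩) rfl,
      ← h.inner_tails_apply hX]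
    change inner ℂ _ (φX + h.tails (a', b')) = _
    rw [inner_add_right, h.inner_E_tails]
    linear_combination Complex.I * hab a' b' hT

theorem tails_swap_mem {X Y : H →ₗ.[ℂ] H} (h : IsLadder r A E M N σ)
    (hX : IsLadderDiff r A M σ X) {U : H →L[ℂ] H} (hU : ∀ n f, A n (U f) = (r : ℂ) • A (n + 1) f)
    (hXY : X ≤ Y) (hUY : ∀ f ∈ Y.domain, U f ∈ Y.domain) {a b : K}
    (hab : h.tails (a, b) ∈ Y.domain) : h.tails (b, a) ∈ Y.domain := by
  have h1 := hUY _ hab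
  rw [tails_apply, map_add, h.U_tail_one hU, h.U_tail_zero hU, ← smul_add,
    Submodule.smul_mem_iff _ h.rc_ne] at h1
  have h2 := sub_mem h1 (hXY.1 (h.E_mem_domain hX (-1) ((r : ℂ) ^ (-2 : ℤ) • N a)))
  convert h2 using 1
  rw [tails_apply]; abel

end Complete

end IsLadder

/-- A subspace of `F₁ × F₂` which is its own orthogonal complement for the difference of the two
inner products is the graph of a unitary. -/
theorem exists_linearIsometryEquiv_of_lagrangian {F₁ F₂ : Type*}
    [NormedAddCommGroup F₁] [InnerProductSpace ℂ F₁] [CompleteSpace F₁]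
    [NormedAddCommGroup F₂] [InnerProductSpace ℂ F₂] [CompleteSpace F₂]
    (L : Submodule ℂ (F₁ × F₂))
    (hL : ∀ z, z ∈ L ↔ ∀ w ∈ L, inner ℂ z.1 w.1 = inner ℂ z.2 w.2) :
    ∃ V : F₂ ≃ₗᵢ[ℂ] F₁, ∀ z : F₁ × F₂, z ∈ L ↔ z.1 = V z.2 := by
  have hnorm : ∀ z ∈ L, ‖z.1‖ = ‖z.2‖ := fun z hz => by
    have := (hL z).1 hz z hz
    rw [inner_self_eq_norm_sq_to_K, inner_self_eq_norm_sq_to_K] at this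
    have h2 : ‖z.1‖ ^ 2 = ‖z.2‖ ^ 2 := by exact_mod_cast this
    exact (sq_eq_sq₀ (norm_nonneg _) (norm_nonneg _)).1 h2
  have hclosed : IsClosed (L : Set (F₁ × F₂)) := by
    have : (L : Set (F₁ × F₂)) =
        ⋂ w ∈ L, {z | inner ℂ z.1 w.1 = inner ℂ z.2 w.2} := by
      ext z; simpa using hL z
    rw [this]
    refine isClosed_biInter fun w _ => isClosed_eq ?_ ?_ <;> fun_prop
  have : CompleteSpace L := hclosed.completeSpace_coe
  let p : L →ₗᵢ[ℂ] F₁ := ⟨(LinearMap.fst ℂ F₁ F₂).comp L.subtype, fun z => by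
    change ‖(z : F₁ × F₂).1‖ = ‖(z : F₁ × F₂)‖
    rw [Prod.norm_def, ← hnorm _ z.2, max_self]⟩
  let s : L →ₗᵢ[ℂ] F₂ := ⟨(LinearMap.snd ℂ F₁ F₂).comp L.subtype, fun z => by
    change ‖(z : F₁ × F₂).2‖ = ‖(z : F₁ × F₂)‖
    rw [Prod.norm_def, hnorm _ z.2, max_self]⟩
  have hp : Function.Surjective p := by
    have : CompleteSpace (LinearMap.range p.toLinearMap) :=
      p.isometry.isClosedEmbedding.isClosed_range.completeSpace_coe
    refine LinearMap.range_eq_top.1 (Submodule.orthogonal_eq_bot_iff.1 ?_)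
    rw [Submodule.eq_bot_iff]
    intro x hx
    have hm : ((x, 0) : F₁ × F₂) ∈ L := (hL _).2 fun w hw => by
      have := hx (p ⟨w, hw⟩) ⟨_, rfl⟩
      rw [inner_zero_left, ← inner_conj_symm]
      exact (congrArg _ this).trans (map_zero _)
    simpa using hnorm _ hm
  have hs : Function.Surjective s := by
    have : CompleteSpace (LinearMap.range s.toLinearMap) :=
      s.isometry.isClosedEmbedding.isClosed_range.completeSpace_coe
    refine LinearMap.range_eq_top.1 (Submodule.orthogonal_eq_bot_iff.1 ?_)
    rw [Submodule.eq_bot_iff]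
    intro x hx
    have hm : ((0, x) : F₁ × F₂) ∈ L := (hL _).2 fun w hw => by
      have := hx (s ⟨w, hw⟩) ⟨_, rfl⟩
      rw [inner_zero_left, ← inner_conj_symm]
      exact ((congrArg _ this).trans (map_zero _)).symm
    simpa using (hnorm _ hm).symm
  let eP := LinearIsometryEquiv.ofSurjective p hp
  let eS := LinearIsometryEquiv.ofSurjective s hs
  refine ⟨eS.symm.trans eP, fun z => ⟨fun hz => ?_, fun hz => ?_⟩⟩
  · have : eS.symm z.2 = ⟨z, hz⟩ := by
      rw [LinearIsometryEquiv.symm_apply_eq]; rfl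
    rw [LinearIsometryEquiv.trans_apply, this]; rfl
  · have h1 : (eS.symm z.2 : F₁ × F₂).1 = z.1 := hz.symm
    have h2 : (eS.symm z.2 : F₁ × F₂).2 = z.2 := eS.apply_symm_apply z.2
    rw [← Prod.ext h1 h2]
    exact (eS.symm z.2).2

/-- Shift-invariant self-adjoint extensions are described by a pair of unitaries between the
positive and the negative boundary space. -/
theorem IsLadder.exists_unitaries {H K F₁ F₂ : Type*}
    [NormedAddCommGroup H] [InnerProductSpace ℂ H] [CompleteSpace H]
    [NormedAddCommGroup K] [InnerProductSpace ℂ K]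
    [NormedAddCommGroup F₁] [InnerProductSpace ℂ F₁] [CompleteSpace F₁]
    [NormedAddCommGroup F₂] [InnerProductSpace ℂ F₂] [CompleteSpace F₂]
    {r : ℝ} {A : ℤ → H →L[ℂ] K} {E : ℤ → K →L[ℂ] H} {M N σ : K →L[ℂ] K} {X Y : H →ₗ.[ℂ] H}
    (h : IsLadder r A E M N σ) (hX : IsLadderDiff r A M σ X) {U : H →L[ℂ] H}
    (hU : ∀ n f, A n (U f) = (r : ℂ) • A (n + 1) f) (hU1 : ‖U‖ ≤ 1)
    (hXY : X ≤ Y) (hY : IsSelfAdjoint Y) (hUY : ∀ f ∈ Y.domain, U f ∈ Y.domain)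
    (ρ : K ≃ₗ[ℂ] F₁ × F₂)
    (hρ : ∀ x y, inner ℂ (σ x) y = inner ℂ (ρ x).1 (ρ y).1 - inner ℂ (ρ x).2 (ρ y).2) :
    ∃ V W : F₂ ≃ₗᵢ[ℂ] F₁, ∀ f, f ∈ Y.domain ↔
      ∃ a b, (f ∈ X.adjoint.domain ∧ ∃ fX ∈ X.domain, f = fX + (h.tail 0 a + h.tail 1 b)) ∧
        (ρ a).1 + (ρ b).1 = V ((ρ a).2 + (ρ b).2) ∧
        (ρ a).1 - (ρ b).1 = W ((ρ a).2 - (ρ b).2) := by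
  have hiff := h.tails_mem_iff hX hU hU1 hXY hY
  have hswap := fun a b hab => h.tails_swap_mem hX hU hXY hUY (a := a) (b := b) hab
  let D : Submodule ℂ (K × K) := Y.domain.comap h.tails
  let Lu : Submodule ℂ (F₁ × F₂) :=
    D.comap (ρ.symm.toLinearMap.prod ρ.symm.toLinearMap)
  let Lv : Submodule ℂ (F₁ × F₂) :=
    D.comap (ρ.symm.toLinearMap.prod (-ρ.symm.toLinearMap))
  have hLu : ∀ k, ρ k ∈ Lu ↔ (k, k) ∈ D := fun k => by
    change (ρ.symm (ρ k), ρ.symm (ρ k)) ∈ D ↔ _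
    rw [ρ.symm_apply_apply]
  have hLv : ∀ k, ρ k ∈ Lv ↔ (k, -k) ∈ D := fun k => by
    change (ρ.symm (ρ k), -ρ.symm (ρ k)) ∈ D ↔ _
    rw [ρ.symm_apply_apply]
  have hsum : ∀ a b, (a, b) ∈ D → (a + b, a + b) ∈ D := fun a b hab => by
    have := add_mem hab (hswap a b hab)
    rwa [Prod.mk_add_mk, add_comm b a] at this
  have hdiff : ∀ a b, (a, b) ∈ D → (a - b, -(a - b)) ∈ D := fun a b hab => by
    have := sub_mem hab (hswap a b hab)
    rwa [Prod.mk_sub_mk, ← neg_sub a b] at this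
  obtain ⟨V, hV⟩ := exists_linearIsometryEquiv_of_lagrangian Lu fun z => by
    obtain ⟨k, rfl⟩ := ρ.surjective z
    rw [hLu]
    constructor
    · intro hk w hw
      obtain ⟨l, rfl⟩ := ρ.surjective w
      have := (hiff k k).1 hk l l ((hLu l).1 hw)
      rw [hρ] at this
      linear_combination this / 2
    · intro hk
      refine (hiff k k).2 fun a b hab => ?_
      have := hk _ ((hLu _).2 (hsum a b hab))
      rw [← inner_add_right, hρ, this, sub_self]
  obtain ⟨W, hW⟩ := exists_linearIsometryEquiv_of_lagrangian Lv fun z => by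
    obtain ⟨k, rfl⟩ := ρ.surjective z
    rw [hLv]
    constructor
    · intro hk w hw
      obtain ⟨l, rfl⟩ := ρ.surjective w
      have := (hiff k (-k)).1 hk l (-l) ((hLv l).1 hw)
      rw [map_neg, inner_neg_left, inner_neg_right, hρ] at this
      linear_combination -this / 2
    · intro hk
      refine (hiff k (-k)).2 fun a b hab => ?_
      have := hk _ ((hLv _).2 (hdiff a b hab))
      have h2 := hρ k (a - b)
      rw [this, sub_self, inner_sub_right] at h2
      rw [map_neg, inner_neg_left]
      linear_combination -h2
  have hD : ∀ a b, (a, b) ∈ D ↔ (ρ a).1 + (ρ b).1 = V ((ρ a).2 + (ρ b).2) ∧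
      (ρ a).1 - (ρ b).1 = W ((ρ a).2 - (ρ b).2) := fun a b => by
    have h1 := hV (ρ (a + b))
    have h2 := hW (ρ (a - b))
    rw [hLu, map_add, Prod.fst_add, Prod.snd_add] at h1
    rw [hLv, map_sub, Prod.fst_sub, Prod.snd_sub] at h2
    rw [← h1, ← h2]
    refine ⟨fun hab => ⟨hsum a b hab, hdiff a b hab⟩, fun ⟨hu, hv⟩ => ?_⟩
    have := D.smul_mem (1 / 2 : ℂ) (add_mem hu hv)
    convert this using 1
    ext <;> simp <;> module
  refine ⟨V, W, fun f => ⟨fun hf => ?_, ?_⟩⟩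
  · have hf' := (h.le_adjoint_of_isSelfAdjoint hX hXY hY).1 hf
    obtain ⟨fX, hfX, a, b, e⟩ := h.exists_decomposition hX hU hU1 hf'
    refine ⟨a, b, ⟨hf', fX, hfX, e⟩, (hD a b).1 ?_⟩
    change h.tails (a, b) ∈ Y.domain
    rw [show h.tails (a, b) = f - fX by rw [e, h.tails_apply]; abel]
    exact sub_mem hf (hXY.1 hfX)
  · rintro ⟨a, b, ⟨-, fX, hfX, rfl⟩, hab⟩
    exact add_mem (hXY.1 hfX) ((hD a b).2 hab)

theorem exists_lp_map {I : Type*} {E F : I → Type*} [∀ j, NormedAddCommGroup (E j)]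
    [∀ j, NormedSpace ℂ (E j)] [∀ j, NormedAddCommGroup (F j)] [∀ j, NormedSpace ℂ (F j)]
    (T : ∀ j, E j →ₗ[ℂ] F j) (C : ℝ) (hT : ∀ j x, ‖T j x‖ ^ 2 ≤ C * ‖x‖ ^ 2) :
    ∃ S : lp E 2 →L[ℂ] lp F 2, ∀ f j, S f j = T j (f j) := by
  have sq : ∀ x : ℝ, x ^ (2 : ENNReal).toReal = x ^ 2 := fun x => by simp
  have hp : 0 < (2 : ENNReal).toReal := by simp
  have hs : ∀ f : lp E 2, Summable fun j => C * ‖f j‖ ^ 2 := fun f => by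
    have := (lp.memℓp f).summable hp
    simp only [sq] at this
    exact this.mul_left C
  have hs' : ∀ f : lp E 2, Summable fun j => ‖T j (f j)‖ ^ 2 := fun f =>
    (hs f).of_nonneg_of_le (fun j => by positivity) fun j => hT j _
  have hm : ∀ f : lp E 2, Memℓp (fun j => T j (f j)) 2 := fun f =>
    memℓp_gen (by simpa only [sq] using hs' f)
  let L : lp E 2 →ₗ[ℂ] lp F 2 :=
    { toFun := fun f => ⟨fun j => T j (f j), hm f⟩
      map_add' := fun f g => by ext j : 2; exact map_add (T j) _ _
      map_smul' := fun c f => by ext j : 2; exact map_smul (T j) _ _ }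
  refine ⟨L.mkContinuous (Real.sqrt C) fun f => ?_, fun f j => rfl⟩
  refine le_of_sq_le_sq ?_ (by positivity)
  have h1 := lp.norm_rpow_eq_tsum hp (L f)
  have h2 := lp.norm_rpow_eq_tsum hp f
  simp only [sq] at h1 h2
  have h3 : ∑' j, ‖T j (f j)‖ ^ 2 ≤ ∑' j, C * ‖f j‖ ^ 2 :=
    (hs' f).tsum_le_tsum (fun j => hT j _) (hs f)
  rw [tsum_mul_left, ← h2] at h3
  rw [h1, mul_pow]
  rcases le_or_gt 0 C with hC | hC
  · rw [Real.sq_sqrt hC]; exact h3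
  · refine h3.trans ?_
    exact mul_le_mul_of_nonneg_right (hC.le.trans (by positivity)) (by positivity)

theorem exists_weighted_comp_Lp {ν ν' : Measure ℝ} {φ : ℝ → ℂ} {τ : ℝ → ℝ}
    (hφ : Measurable φ) (hτ : Measurable τ) (C : NNReal)
    (h : ∀ g : ℝ → ENNReal, Measurable g →
      ∫⁻ s, ‖φ s‖ₑ ^ 2 * g (τ s) ∂ν' ≤ C * ∫⁻ t, g t ∂ν) :
    ∃ T : Lp ℂ 2 ν →ₗ[ℂ] Lp ℂ 2 ν', (∀ f, ‖T f‖ ^ 2 ≤ C * ‖f‖ ^ 2) ∧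
      ∀ f, ∀ᵐ s ∂ν', T f s = φ s * f (τ s) := by
  have tr : ∀ f g : ℝ → ℂ, f =ᵐ[ν] g → ∀ᵐ s ∂ν', φ s * f (τ s) = φ s * g (τ s) := by
    intro f g hfg
    obtain ⟨S, hS, hSm, hS0⟩ := exists_measurable_superset_of_null hfg
    have h1 := h (S.indicator 1) (measurable_one.indicator hSm)
    rw [lintegral_indicator_one hSm, hS0, mul_zero, nonpos_iff_eq_zero,
      lintegral_eq_zero_iff (by
        exact (hφ.enorm.pow_const 2).mul ((measurable_one.indicator hSm).comp hτ))] at h1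
    filter_upwards [h1] with s hs
    by_cases h2 : f (τ s) = g (τ s)
    · rw [h2]
    · have : τ s ∈ S := hS h2
      simp [this] at hs
      simp [hs]
  have nrm : ∀ f : Lp ℂ 2 ν, eLpNorm (fun s => φ s * f (τ s)) 2 ν' ^ 2 ≤
      C * eLpNorm f 2 ν ^ 2 := by
    intro f
    have e : ∀ (μ : Measure ℝ) (g : ℝ → ℂ), eLpNorm g 2 μ ^ 2 = ∫⁻ s, ‖g s‖ₑ ^ 2 ∂μ := by
      intro μ g
      rw [eLpNorm_eq_lintegral_rpow_enorm_toReal (by simp) (by simp), ← ENNReal.rpow_natCast,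
        ← ENNReal.rpow_mul]
      simp
    rw [e, e]
    have := h (fun t => ‖f t‖ₑ ^ 2) ((Lp.stronglyMeasurable f).measurable.enorm.pow_const 2)
    simpa [enorm_mul, mul_pow] using this
  have mem : ∀ f : Lp ℂ 2 ν, MemLp (fun s => φ s * f (τ s)) 2 ν' := by
    intro f
    refine ⟨(hφ.mul ((Lp.stronglyMeasurable f).measurable.comp hτ)).aestronglyMeasurable, ?_⟩
    have h1 : C * eLpNorm f 2 ν ^ 2 < ⊤ :=
      ENNReal.mul_lt_top (by simp) (ENNReal.pow_lt_top (Lp.eLpNorm_lt_top f))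
    exact lt_top_iff_ne_top.2 fun h2 => by
      have := (nrm f).trans_lt h1
      simp [h2] at this
  refine ⟨
    { toFun := fun f => (mem f).toLp _
      map_add' := fun f g => ?_
      map_smul' := fun c f => ?_ }, fun f => ?_, fun f => (mem f).coeFn_toLp⟩
  · rw [← MemLp.toLp_add, MemLp.toLp_eq_toLp_iff]
    filter_upwards [tr _ _ (Lp.coeFn_add f g)] with s hs
    rw [hs]; simp [mul_add]
  · rw [RingHom.id_apply, ← MemLp.toLp_const_smul, MemLp.toLp_eq_toLp_iff]
    filter_upwards [tr _ _ (Lp.coeFn_smul c f)] with s hs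
    rw [hs]; simp; ring
  · have h1 := nrm f
    have h2 := ENNReal.toReal_mono
      (ENNReal.mul_ne_top (by simp) (ENNReal.pow_ne_top (Lp.eLpNorm_ne_top f))) h1
    simpa [Lp.norm_def, eLpNorm_congr_ae (mem f).coeFn_toLp] using h2

theorem exists_weighted_comp {I : Type*} {ν ν' : I → Measure ℝ} {φ : I → ℝ → ℂ} {τ : I → ℝ → ℝ}
    (hφ : ∀ j, Measurable (φ j)) (hτ : ∀ j, Measurable (τ j)) (C : NNReal)
    (h : ∀ j, ∀ g : ℝ → ENNReal, Measurable g →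
      ∫⁻ s, ‖φ j s‖ₑ ^ 2 * g (τ j s) ∂ν' j ≤ C * ∫⁻ t, g t ∂ν j) :
    ∃ T : HS ν →L[ℂ] HS ν', ∀ f j, ∀ᵐ s ∂ν' j, T f j s = φ j s * f j (τ j s) := by
  choose T hT1 hT2 using fun j => exists_weighted_comp_Lp (hφ j) (hτ j) C (h j)
  obtain ⟨S, hS⟩ := exists_lp_map T C hT1
  exact ⟨S, fun f j => by rw [hS]; exact hT2 j _⟩

/-- The point at height `n` above `s` on the half-axis of sign `e`. -/
def rung (q e : ℝ) (n : ℤ) (s : ℝ) : ℝ := e * (q ^ n * s)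

/-- The measure on the half-axis of sign `e` induced by the measure `μ1` on `[q, 1)`. -/
structure IsInduced (q e : ℝ) (μ1 μ : Measure ℝ) : Prop where
  sign : e * e = 1
  null : μ {t | 0 < e * t}ᶜ = 0
  image : ∀ S : Set ℝ, MeasurableSet S → S ⊆ Set.Ico q 1 → ∀ n : ℤ,
    μ (rung q e n '' S) = ENNReal.ofReal (q ^ n) * μ1 S
  supp : μ1 (Set.Ico q 1)ᶜ = 0

section Rung

variable {q e : ℝ}

theorem ne_zero_of_mul_self_eq_one (he : e * e = 1) : e ≠ 0 := left_ne_zero_of_mul_eq_one he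

theorem rung_eq (n : ℤ) : rung q e n = fun s => (e * q ^ n) * s := by
  ext s; simp [rung, mul_assoc]

theorem measurableEmbedding_rung (hq : 0 < q) (he : e * e = 1) (n : ℤ) :
    MeasurableEmbedding (rung q e n) := by
  rw [rung_eq]
  exact (Homeomorph.mulLeft₀ _
    (mul_ne_zero (ne_zero_of_mul_self_eq_one he) (zpow_ne_zero n hq.ne'))).measurableEmbedding

theorem exists_rung (hq : 0 < q) (hq1 : q < 1) (he : e * e = 1) {t : ℝ} (ht : 0 < e * t) :
    ∃ n : ℤ, ∃ s ∈ Set.Ico q 1, rung q e n s = t := by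
  obtain ⟨n, hn, hn'⟩ := exists_mem_Ico_zpow ht ((one_lt_inv₀ hq).2 hq1)
  rw [inv_zpow'] at hn hn'
  have h1 : 0 < q ^ (n + 1) := by positivity
  refine ⟨-(n + 1), q ^ (n + 1) * (e * t), ⟨?_, ?_⟩, ?_⟩
  · calc q = q ^ (n + 1) * q ^ (-n) := by
          rw [← zpow_add₀ hq.ne', show n + 1 + -n = 1 by ring, zpow_one]
      _ ≤ _ := mul_le_mul_of_nonneg_left hn h1.le
  · calc q ^ (n + 1) * (e * t) < q ^ (n + 1) * q ^ (-(n + 1)) := mul_lt_mul_of_pos_left hn' h1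
      _ = 1 := by rw [← zpow_add₀ hq.ne']; simp
  · rw [rung, zpow_neg, inv_mul_cancel_left₀ h1.ne', ← mul_assoc, he, one_mul]

theorem rung_inj (hq : 0 < q) (hq1 : q < 1) (he : e * e = 1) {m n : ℤ} {s t : ℝ}
    (hs : s ∈ Set.Ico q 1) (ht : t ∈ Set.Ico q 1) (h : rung q e m s = rung q e n t) :
    m = n ∧ s = t := by
  have h1 : q ^ m * s = q ^ n * t := mul_left_cancel₀ (ne_zero_of_mul_self_eq_one he) h
  have key : ∀ {m n : ℤ} {s t : ℝ}, s ∈ Set.Ico q 1 → t ∈ Set.Ico q 1 →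
      q ^ m * s = q ^ n * t → ¬ m < n := by
    intro m n s t hs ht h hmn
    have h2 : q ^ n * t < q ^ n := mul_lt_of_lt_one_right (by positivity) ht.2
    have h3 : q ^ n ≤ q ^ (m + 1) := zpow_le_zpow_right_of_le_one₀ hq hq1.le hmn
    have h4 : q ^ (m + 1) ≤ q ^ m * s := by
      rw [zpow_add_one₀ hq.ne']; exact mul_le_mul_of_nonneg_left hs.1 (by positivity)
    linarith
  have h5 : m = n := le_antisymm (not_lt.1 (key ht hs h1.symm)) (not_lt.1 (key hs ht h1))
  subst h5
  exact ⟨rfl, mul_left_cancel₀ (zpow_ne_zero m hq.ne') h1⟩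

end Rung

theorem lintegral_wd {μ1 : Measure ℝ} (g : ℝ → ENNReal) (hg : Measurable g) :
    ∫⁻ s, g s ∂wd μ1 = ∫⁻ s, ENNReal.ofReal s⁻¹ * g s ∂μ1 := by
  rw [wd, lintegral_withDensity_eq_lintegral_mul _ (by fun_prop) hg]; rfl

namespace IsInduced

variable {q e : ℝ} {μ1 μ : Measure ℝ}

theorem ae_mem (h : IsInduced q e μ1 μ) : ∀ᵐ s ∂μ1, s ∈ Set.Ico q 1 := h.supp

theorem restrict_eq (h : IsInduced q e μ1 μ) (hq : 0 < q) (n : ℤ) :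
    μ.restrict (rung q e n '' Set.Ico q 1) =
      ENNReal.ofReal (q ^ n) • μ1.map (rung q e n) := by
  have hτ := measurableEmbedding_rung hq h.sign n
  ext S hS
  rw [Measure.restrict_apply hS, Measure.smul_apply, hτ.map_apply, smul_eq_mul,
    Set.inter_comm, Set.image_inter_preimage (f := rung q e n) (Set.Ico q 1) S |>.symm,
    h.image _ (measurableSet_Ico.inter (hτ.measurable hS)) Set.inter_subset_left]
  congr 1
  refine measure_congr ?_
  filter_upwards [h.ae_mem] with s hs
  exact propext ⟨fun h => h.2, fun h => ⟨hs, h⟩⟩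

theorem lintegral_rung (h : IsInduced q e μ1 μ) (hq : 0 < q) (n : ℤ) (F : ℝ → ENNReal) :
    ∫⁻ t in rung q e n '' Set.Ico q 1, F t ∂μ =
      ENNReal.ofReal (q ^ n) * ∫⁻ s, F (rung q e n s) ∂μ1 := by
  rw [h.restrict_eq hq, lintegral_smul_measure, smul_eq_mul,
    (measurableEmbedding_rung hq h.sign n).lintegral_map]

theorem integral_rung (h : IsInduced q e μ1 μ) (hq : 0 < q) (n : ℤ) (F : ℝ → ℂ) :
    ∫ t in rung q e n '' Set.Ico q 1, F t ∂μ =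
      (q : ℂ) ^ n * ∫ s, F (rung q e n s) ∂μ1 := by
  rw [h.restrict_eq hq, integral_smul_measure,
    (measurableEmbedding_rung hq h.sign n).integral_map,
    ENNReal.toReal_ofReal (by positivity)]
  simp

theorem ae_wd (h : IsInduced q e μ1 μ) (hq : 0 < q) {P : ℝ → Prop} :
    (∀ᵐ s ∂wd μ1, P s) ↔ ∀ᵐ s ∂μ1, P s := by
  rw [wd, ae_withDensity_iff (by fun_prop)]
  refine Filter.eventually_congr ?_
  filter_upwards [h.ae_mem] with s hs
  have : 0 < s := hq.trans_le hs.1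
  simp [this]

theorem ae_iff (h : IsInduced q e μ1 μ) (hq : 0 < q) (hq1 : q < 1) {P : ℝ → Prop} :
    (∀ᵐ t ∂μ, P t) ↔ ∀ n : ℤ, ∀ᵐ s ∂wd μ1, P (rung q e n s) := by
  have e1 : ∀ n : ℤ, (∀ᵐ s ∂wd μ1, P (rung q e n s)) ↔
      ∀ᵐ t ∂μ.restrict (rung q e n '' Set.Ico q 1), P t := fun n => by
    have hc : ENNReal.ofReal (q ^ n) ≠ 0 := by simpa using zpow_pos hq n
    have hs : ∀ m : Measure ℝ, (∀ᵐ t ∂ENNReal.ofReal (q ^ n) • m, P t) ↔ ∀ᵐ t ∂m, P t := fun m => by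
      simp only [MeasureTheory.ae_iff, Measure.smul_apply, smul_eq_mul, mul_eq_zero, hc, false_or]
    rw [h.ae_wd hq, h.restrict_eq hq, hs, (measurableEmbedding_rung hq h.sign n).ae_map_iff]
  simp_rw [e1]
  rw [← ae_restrict_iUnion_iff]
  rw [Measure.restrict_eq_self_of_ae_mem]
  filter_upwards [show ∀ᵐ t ∂μ, t ∈ {t | 0 < e * t} from h.null] with t ht
  obtain ⟨n, s, hs, rfl⟩ := exists_rung hq hq1 h.sign ht
  exact Set.mem_iUnion.2 ⟨n, s, hs, rfl⟩

theorem integral_wd (h : IsInduced q e μ1 μ) (hq : 0 < q) (g : ℝ → ℂ) :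
    ∫ s, g s ∂wd μ1 = ∫ s, (s : ℂ)⁻¹ * g s ∂μ1 := by
  rw [wd, integral_withDensity_eq_integral_toReal_smul (by fun_prop) (by simp)]
  refine integral_congr_ae ?_
  filter_upwards [h.ae_mem] with s hs
  have : 0 < s := hq.trans_le hs.1
  rw [ENNReal.toReal_ofReal (by positivity)]
  simp

end IsInduced

theorem sqrt_zpow_neg_two_mul {q : ℝ} (hq : 0 < q) (n : ℤ) :
    (√q : ℂ) ^ (-(2 * n)) = (q : ℂ) ^ (-n) := by
  rw [show -(2 * n) = 2 * (-n) by ring, zpow_mul]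
  congr 1
  exact_mod_cast Real.sq_sqrt hq.le

section Operators

variable {q : ℝ} {I : Type*} {e : I → ℝ} {μ1 μ : I → Measure ℝ}

theorem exists_rungRestrict (hq : 0 < q) (h : ∀ j, IsInduced q (e j) (μ1 j) (μ j)) (n : ℤ) :
    ∃ A : HS μ →L[ℂ] HS (fun j => wd (μ1 j)), ∀ f j,
      ∀ᵐ s ∂wd (μ1 j), A f j s = f j (rung q (e j) n s) := by
  have hr : ∀ j, Measurable (rung q (e j) n) := fun j =>
    (measurableEmbedding_rung hq (h j).sign n).measurable
  suffices hb : ∀ j, ∀ g : ℝ → ENNReal, Measurable g →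
      ∫⁻ s, ‖(1 : ℂ)‖ₑ ^ 2 * g (rung q (e j) n s) ∂wd (μ1 j) ≤
        Real.toNNReal (q⁻¹ * q ^ (-n)) * ∫⁻ t, g t ∂μ j by
    obtain ⟨T, hT⟩ := exists_weighted_comp (φ := fun _ _ => 1) (fun _ => measurable_const) hr _ hb
    exact ⟨T, fun f j => by simpa using hT f j⟩
  intro j g hg
  simp only [enorm_one, one_pow, one_mul]
  have hg' : Measurable fun s => g (rung q (e j) n s) := hg.comp (hr j)
  rw [lintegral_wd _ hg']
  calc ∫⁻ s, ENNReal.ofReal s⁻¹ * g (rung q (e j) n s) ∂μ1 j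
      ≤ ∫⁻ s, ENNReal.ofReal q⁻¹ * g (rung q (e j) n s) ∂μ1 j := by
        refine lintegral_mono_ae ?_
        filter_upwards [(h j).ae_mem] with s hs
        gcongr
        exact hs.1
    _ = ENNReal.ofReal (q⁻¹ * q ^ (-n)) *
          (ENNReal.ofReal (q ^ n) * ∫⁻ s, g (rung q (e j) n s) ∂μ1 j) := by
        rw [lintegral_const_mul _ hg', ← mul_assoc,
          ← ENNReal.ofReal_mul (by positivity), mul_assoc, ← zpow_add₀ hq.ne']
        simp
    _ ≤ _ := by
        rw [← (h j).lintegral_rung hq]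
        gcongr
        · rfl
        · exact Measure.restrict_le_self

theorem exists_mul (hq : 0 < q) (h : ∀ j, IsInduced q (e j) (μ1 j) (μ j))
    (ψ : I → ℝ → ℂ) (hψ : ∀ j, Measurable (ψ j)) (C : ℝ)
    (hC : ∀ j, ∀ s ∈ Set.Ico q 1, ‖ψ j s‖ ≤ C) :
    ∃ T : HS (fun j => wd (μ1 j)) →L[ℂ] HS (fun j => wd (μ1 j)), ∀ f j,
      ∀ᵐ s ∂wd (μ1 j), T f j s = ψ j s * f j s := by
  refine exists_weighted_comp hψ (fun _ => measurable_id) (Real.toNNReal (C ^ 2)) ?_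
  intro j g hg
  rw [← lintegral_const_mul _ hg]
  refine lintegral_mono_ae ?_
  filter_upwards [((h j).ae_wd hq).2 (h j).ae_mem] with s hs
  gcongr
  rw [← ofReal_norm, ← ENNReal.ofReal_pow (norm_nonneg _)]
  exact ENNReal.ofReal_le_ofReal (pow_le_pow_left₀ (norm_nonneg _) (hC j s hs) 2)

theorem rung_neg_rung (hq : 0 < q) {e : ℝ} (he : e * e = 1) (n : ℤ) (s : ℝ) :
    rung q e (-n) (rung q e n s) = s := by
  have : q ^ n ≠ 0 := zpow_ne_zero _ hq.ne'
  rw [rung, rung, zpow_neg]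
  field_simp
  linear_combination s * he

theorem exists_rungExtend (hq : 0 < q) (hq1 : q < 1)
    (h : ∀ j, IsInduced q (e j) (μ1 j) (μ j)) (n : ℤ) :
    ∃ E : HS (fun j => wd (μ1 j)) →L[ℂ] HS μ, ∀ k j m,
      ∀ᵐ s ∂wd (μ1 j), E k j (rung q (e j) m s) =
        if m = n then (q : ℂ) ^ (-n) * ((s : ℂ)⁻¹ * k j s) else 0 := by
  have hr : ∀ n j, MeasurableEmbedding (rung q (e j) n) := fun n j =>
    measurableEmbedding_rung hq (h j).sign n
  let φ : I → ℝ → ℂ := fun j =>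
    (rung q (e j) n '' Set.Ico q 1).indicator fun t => ((e j * t : ℝ) : ℂ)⁻¹
  have hφ : ∀ j, Measurable (φ j) := fun j =>
    Measurable.indicator (by fun_prop) ((hr n j).measurableSet_image.2 measurableSet_Ico)
  suffices hb : ∀ j, ∀ g : ℝ → ENNReal, Measurable g →
      ∫⁻ t, ‖φ j t‖ₑ ^ 2 * g (rung q (e j) (-n) t) ∂μ j ≤
        Real.toNNReal (q⁻¹ * q ^ (-n)) * ∫⁻ s, g s ∂wd (μ1 j) by
    obtain ⟨T, hT⟩ := exists_weighted_comp hφ (fun j => (hr (-n) j).measurable) _ hb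
    have hv : ∀ j m, ∀ s ∈ Set.Ico q 1,
        φ j (rung q (e j) m s) = if m = n then (q : ℂ) ^ (-n) * (s : ℂ)⁻¹ else 0 := by
      intro j m s hs
      split_ifs with hmn
      · subst hmn
        simp only [φ]
        rw [Set.indicator_of_mem (Set.mem_image_of_mem _ hs), rung, ← mul_assoc, (h j).sign]
        simp [mul_comm]
      · refine Set.indicator_of_notMem ?_ _
        rintro ⟨t, ht, hts⟩
        exact hmn (rung_inj hq hq1 (h j).sign hs ht hts.symm).1
    refine ⟨T, fun k j m => ?_⟩
    filter_upwards [((h j).ae_iff hq hq1).1 (hT k j) m, ((h j).ae_wd hq).2 (h j).ae_mem] with s hs hs'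
    refine hs.trans ?_
    rw [hv j m s hs']
    split_ifs with hmn
    · subst hmn
      rw [rung_neg_rung hq (h j).sign, mul_assoc]
    · exact zero_mul _
  intro j g hg
  have e1 : ∀ t, ‖φ j t‖ₑ ^ 2 * g (rung q (e j) (-n) t) =
      (rung q (e j) n '' Set.Ico q 1).indicator
        (fun t => ‖((e j * t : ℝ) : ℂ)⁻¹‖ₑ ^ 2 * g (rung q (e j) (-n) t)) t := by
    intro t
    by_cases ht : t ∈ rung q (e j) n '' Set.Ico q 1 <;> simp [φ, ht]
  simp_rw [e1]
  rw [lintegral_indicator ((hr n j).measurableSet_image.2 measurableSet_Ico),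
    (h j).lintegral_rung hq, lintegral_wd _ hg]
  simp only [rung_neg_rung hq (h j).sign]
  rw [← lintegral_const_mul' _ _ (by simp), ← lintegral_const_mul' _ _ (by simp)]
  refine lintegral_mono_ae ?_
  filter_upwards [(h j).ae_mem] with s hs
  have hs0 : 0 < s := hq.trans_le hs.1
  rw [rung, ← mul_assoc (e j), (h j).sign, one_mul, ← mul_assoc, ← mul_assoc]
  gcongr ?_ * g s
  rw [← ofReal_norm, ← ENNReal.ofReal_pow (norm_nonneg _),
    ← ENNReal.ofReal_mul (by positivity)]
  change _ ≤ ENNReal.ofReal _ * _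
  rw [← ENNReal.ofReal_mul (by positivity)]
  refine ENNReal.ofReal_le_ofReal ?_
  rw [norm_inv, Complex.norm_real, Real.norm_of_nonneg (by positivity), mul_inv, mul_pow,
    ← zpow_neg]
  have h1 : q ^ n * q ^ (-n) = 1 := by rw [← zpow_add₀ hq.ne']; simp
  have h2 : s⁻¹ ≤ q⁻¹ := inv_anti₀ hq hs.1
  calc q ^ n * ((q ^ (-n)) ^ 2 * s⁻¹ ^ 2) = (q ^ n * q ^ (-n)) * (s⁻¹ * (q ^ (-n) * s⁻¹)) := by ring
    _ = s⁻¹ * (q ^ (-n) * s⁻¹) := by rw [h1, one_mul]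
    _ ≤ q⁻¹ * (q ^ (-n) * s⁻¹) := by gcongr
    _ = _ := by ring

theorem inner_rungExtend (hq : 0 < q) (hq1 : q < 1)
    (h : ∀ j, IsInduced q (e j) (μ1 j) (μ j)) {n : ℤ}
    {A : HS μ →L[ℂ] HS (fun j => wd (μ1 j))} {E : HS (fun j => wd (μ1 j)) →L[ℂ] HS μ}
    (hA : ∀ f j, ∀ᵐ s ∂wd (μ1 j), A f j s = f j (rung q (e j) n s))
    (hE : ∀ k j m, ∀ᵐ s ∂wd (μ1 j), E k j (rung q (e j) m s) =
        if m = n then (q : ℂ) ^ (-n) * ((s : ℂ)⁻¹ * k j s) else 0) (k f) :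
    inner ℂ (E k) f = inner ℂ k (A f) := by
  rw [lp.inner_eq_tsum, lp.inner_eq_tsum]
  refine tsum_congr fun j => ?_
  rw [L2.inner_def, L2.inner_def, (h j).integral_wd hq]
  have hs : MeasurableSet (rung q (e j) n '' Set.Ico q 1) :=
    (measurableEmbedding_rung hq (h j).sign n).measurableSet_image.2 measurableSet_Ico
  have h0 : ∀ᵐ t ∂μ j, t ∉ rung q (e j) n '' Set.Ico q 1 → inner ℂ (E k j t) (f j t) = 0 := by
    rw [(h j).ae_iff hq hq1]
    intro m
    filter_upwards [hE k j m, ((h j).ae_wd hq).2 (h j).ae_mem] with s hs hs' hn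
    have hmn : m ≠ n := by rintro rfl; exact hn ⟨s, hs', rfl⟩
    rw [if_neg hmn] at hs
    rw [hs, inner_zero_left]
  rw [← setIntegral_eq_integral_of_ae_compl_eq_zero h0, (h j).integral_rung hq,
    ← integral_const_mul]
  refine integral_congr_ae ?_
  filter_upwards [((h j).ae_wd hq).1 (hE k j n), ((h j).ae_wd hq).1 (hA f j)] with s h1 h2
  rw [if_pos rfl] at h1
  rw [h1, h2]
  have : (q : ℂ) ^ n ≠ 0 := zpow_ne_zero _ (by exact_mod_cast hq.ne')
  simp only [RCLike.inner_apply, map_mul, map_inv₀, map_zpow₀, Complex.conj_ofReal, zpow_neg]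
  field_simp

theorem HS_ext {I : Type*} {ν : I → Measure ℝ} {f g : HS ν}
    (h : ∀ j, ∀ᵐ s ∂ν j, f j s = g j s) : f = g := by
  refine Subtype.ext (funext fun j => ?_)
  exact Lp.ext (h j)

theorem exists_isLadder (hq : 0 < q) (hq1 : q < 1)
    (h : ∀ j, IsInduced q (e j) (μ1 j) (μ j)) :
    ∃ (A : ℤ → HS μ →L[ℂ] HS (fun j => wd (μ1 j))) (E : ℤ → HS (fun j => wd (μ1 j)) →L[ℂ] HS μ)
      (M N σ : HS (fun j => wd (μ1 j)) →L[ℂ] HS (fun j => wd (μ1 j))),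
      IsLadder √q A E M N σ ∧
      (∀ n f j, ∀ᵐ s ∂wd (μ1 j), A n f j s = f j (rung q (e j) n s)) ∧
      (∀ f j, ∀ᵐ s ∂wd (μ1 j), M f j s = (s : ℂ)⁻¹ * f j s) ∧
      (∀ f j, ∀ᵐ s ∂wd (μ1 j), σ f j s = (e j : ℂ) * f j s) := by
  choose A hA using exists_rungRestrict hq h
  choose E hE using exists_rungExtend hq hq1 h
  obtain ⟨M, hM⟩ := exists_mul hq h (fun _ s => (s : ℂ)⁻¹) (fun _ => by fun_prop) q⁻¹ (by
    intro j s hs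
    rw [norm_inv, Complex.norm_real, Real.norm_of_nonneg (hq.le.trans hs.1)]
    exact inv_anti₀ hq hs.1)
  obtain ⟨N, hN⟩ := exists_mul hq h (fun _ s => (s : ℂ)) (fun _ => by fun_prop) 1 (by
    intro j s hs
    rw [Complex.norm_real, Real.norm_of_nonneg (hq.le.trans hs.1)]
    exact hs.2.le)
  obtain ⟨σ, hσ⟩ := exists_mul hq h (fun j _ => (e j : ℂ)) (fun _ => by fun_prop) 1 (by
    intro j s hs
    rw [Complex.norm_real, Real.norm_eq_abs]
    exact (abs_eq zero_le_one).2 (mul_self_eq_one_iff.1 (h j).sign) |>.le)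
  have hmem : ∀ j, ∀ᵐ s ∂wd (μ1 j), s ∈ Set.Ico q 1 := fun j => ((h j).ae_wd hq).2 (h j).ae_mem
  have he : ∀ j, (e j : ℂ) * e j = 1 := fun j => by exact_mod_cast (h j).sign
  refine ⟨A, E, M, N, σ, ?_, hA, hM, hσ⟩
  constructor
  · exact Real.sqrt_pos.2 hq
  · rw [Real.sqrt_lt' one_pos]; simpa using hq1
  · exact fun n k f => inner_rungExtend hq hq1 h (hA n) (hE n) k f
  · intro n k
    refine HS_ext fun j => ?_
    rw [sqrt_zpow_neg_two_mul hq]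
    filter_upwards [hA n (E n k) j, hE n k j n, hM k j,
      Lp.coeFn_smul ((q : ℂ) ^ (-n)) (M k j)] with s h1 h2 h3 h4
    rw [if_pos rfl] at h2
    refine (h1.trans h2).trans (Eq.trans ?_ h4.symm)
    rw [Pi.smul_apply, h3, smul_eq_mul]
  · intro m n k hmn
    refine HS_ext fun j => ?_
    filter_upwards [hA m (E n k) j, hE n k j m, Lp.coeFn_zero ℂ 2 (wd (μ1 j))] with s h1 h2 h4
    rw [if_neg hmn] at h2
    exact (h1.trans h2).trans h4.symm
  · intro f hf
    refine HS_ext fun j => ?_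
    have h0 : ∀ᵐ t ∂μ j, f j t = 0 := by
      rw [(h j).ae_iff hq hq1]
      intro n
      filter_upwards [hA n f j, Lp.coeFn_zero ℂ 2 (wd (μ1 j))] with s h1 h2
      rw [← h1, hf]
      exact h2
    filter_upwards [h0, Lp.coeFn_zero ℂ 2 (μ j)] with t h1 h2
    exact h1.trans h2.symm
  · intro k
    refine HS_ext fun j => ?_
    filter_upwards [hM (N k) j, hN k j, hmem j] with s h1 h2 h3
    have : (s : ℂ) ≠ 0 := by exact_mod_cast (hq.trans_le h3.1).ne'
    rw [h1, h2, inv_mul_cancel_left₀ this]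
  · intro k
    refine HS_ext fun j => ?_
    filter_upwards [hN (M k) j, hM k j, hmem j] with s h1 h2 h3
    have : (s : ℂ) ≠ 0 := by exact_mod_cast (hq.trans_le h3.1).ne'
    rw [h1, h2, mul_inv_cancel_left₀ this]
  · intro k
    refine HS_ext fun j => ?_
    filter_upwards [hσ (σ k) j, hσ k j] with s h1 h2
    rw [h1, h2, ← mul_assoc, he, one_mul]
  · intro k
    refine HS_ext fun j => ?_
    filter_upwards [hσ (M k) j, hM k j, hM (σ k) j, hσ k j] with s h1 h2 h3 h4
    rw [h1, h2, h3, h4, mul_left_comm]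
  · intro x y
    rw [lp.inner_eq_tsum, lp.inner_eq_tsum]
    refine tsum_congr fun j => ?_
    rw [L2.inner_def, L2.inner_def]
    refine integral_congr_ae ?_
    filter_upwards [hσ x j, hσ y j] with s h1 h2
    rw [h1, h2]
    simp only [RCLike.inner_apply, map_mul, Complex.conj_ofReal]
    ring

end Operators

theorem rung_add_one {q : ℝ} (hq : 0 < q) (e : ℝ) (n : ℤ) (s : ℝ) :
    q * rung q e n s = rung q e (n + 1) s := by
  rw [rung, rung, zpow_add_one₀ hq.ne']; ring

theorem rung_sub_one {q : ℝ} (hq : 0 < q) (e : ℝ) (n : ℤ) (s : ℝ) :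
    q⁻¹ * rung q e n s = rung q e (n - 1) s := by
  rw [rung, rung, zpow_sub_one₀ hq.ne']; ring

theorem ofReal_rung_inv {q e : ℝ} (he : e * e = 1) (n : ℤ) (s : ℝ) :
    (rung q e n s : ℂ)⁻¹ = (q : ℂ) ^ (-n) * (e * (s : ℂ)⁻¹) := by
  have : (e : ℂ)⁻¹ = e := inv_eq_of_mul_eq_one_left (by exact_mod_cast he)
  rw [rung]
  push_cast
  rw [mul_inv, mul_inv, this, zpow_neg]
  ring

section Coordinates

variable {q : ℝ} {I : Type*} {e : I → ℝ} {μ1 μ : I → Measure ℝ}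
  {A : ℤ → HS μ →L[ℂ] HS (fun j => wd (μ1 j))}
  {M σ : HS (fun j => wd (μ1 j)) →L[ℂ] HS (fun j => wd (μ1 j))}

theorem HS_smul_apply {ν : I → Measure ℝ} (c : ℂ) (f : HS ν) (j : I) :
    ∀ᵐ s ∂ν j, (c • f) j s = c * f j s := by
  filter_upwards [Lp.coeFn_smul c (f j)] with s hs
  exact hs

theorem HS_sub_apply {ν : I → Measure ℝ} (f g : HS ν) (j : I) :
    ∀ᵐ s ∂ν j, (f - g) j s = f j s - g j s := by
  filter_upwards [Lp.coeFn_sub (f j) (g j)] with s hs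
  exact hs

theorem HS_add_apply {ν : I → Measure ℝ} (f g : HS ν) (j : I) :
    ∀ᵐ s ∂ν j, (f + g) j s = f j s + g j s := by
  filter_upwards [Lp.coeFn_add (f j) (g j)] with s hs
  exact hs

theorem isLadderDiff_of_isXop (hq : 0 < q) (hq1 : q < 1)
    (h : ∀ j, IsInduced q (e j) (μ1 j) (μ j))
    (hA : ∀ n f j, ∀ᵐ s ∂wd (μ1 j), A n f j s = f j (rung q (e j) n s))
    (hM : ∀ f j, ∀ᵐ s ∂wd (μ1 j), M f j s = (s : ℂ)⁻¹ * f j s)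
    (hσ : ∀ f j, ∀ᵐ s ∂wd (μ1 j), σ f j s = (e j : ℂ) * f j s)
    {X : HS μ →ₗ.[ℂ] HS μ} (hX : IsXop q μ X) : IsLadderDiff √q A M σ X := by
  constructor
  · intro f
    rw [hX.1 f]
    refine exists_congr fun g => ⟨fun hg n => HS_ext fun j => ?_, fun hg j => ?_⟩
    · rw [sqrt_zpow_neg_two_mul hq]
      filter_upwards [hA n g j, hA n f j, hM (A n f) j, hσ (M (A n f)) j,
        HS_smul_apply ((q : ℂ) ^ (-n)) (σ (M (A n f))) j,
        ((h j).ae_iff hq hq1).1 (hg j) n] with s h1 h2 h3 h4 h5 h6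
      rw [h1, h5, h4, h3, h2, h6, ofReal_rung_inv (h j).sign]
      ring
    · rw [(h j).ae_iff hq hq1]
      intro n
      have hn := hg n
      rw [sqrt_zpow_neg_two_mul hq] at hn
      filter_upwards [hA n g j, hA n f j, hM (A n f) j, hσ (M (A n f)) j,
        HS_smul_apply ((q : ℂ) ^ (-n)) (σ (M (A n f))) j] with s h1 h2 h3 h4 h5
      rw [← h1, ← h2, hn, h5, h4, h3, ofReal_rung_inv (h j).sign]
      ring
  · intro f n
    refine HS_ext fun j => ?_
    rw [sqrt_zpow_neg_two_mul hq]
    set g := A (n - 1) f - A (n + 1) f with hg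
    filter_upwards [hA n (X f) j, hA (n - 1) f j, hA (n + 1) f j, hM g j, hσ (M g) j,
      HS_smul_apply (Complex.I * (q : ℂ) ^ (-n)) (σ (M g)) j,
      HS_sub_apply (A (n - 1) f) (A (n + 1) f) j,
      ((h j).ae_iff hq hq1).1 (hX.2 f j) n] with s h1 h2 h3 h4 h5 h6 h7 h8
    rw [h1, h8, h6, h5, h4, hg, h7, h2, h3, ofReal_rung_inv (h j).sign, rung_sub_one hq,
      rung_add_one hq]
    ring

theorem rungRestrict_of_isUop (hq : 0 < q) (hq1 : q < 1)
    (h : ∀ j, IsInduced q (e j) (μ1 j) (μ j))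
    (hA : ∀ n f j, ∀ᵐ s ∂wd (μ1 j), A n f j s = f j (rung q (e j) n s))
    {U : HS μ ≃ₗᵢ[ℂ] HS μ} (hU : IsUop q μ U) (n : ℤ) (f : HS μ) :
    A n (U f) = (√q : ℂ) • A (n + 1) f := by
  refine HS_ext fun j => ?_
  filter_upwards [hA n (U f) j, hA (n + 1) f j, HS_smul_apply (√q : ℂ) (A (n + 1) f) j,
    ((h j).ae_iff hq hq1).1 (hU f j) n] with s h1 h2 h3 h4
  rw [h1, h3, h2, h4, rung_add_one hq, Real.sqrt_eq_rpow]

/-- `F` extends `g : [q, 1) → ℂ` by periodicity to the rungs `k, k + 2, k + 4, …` of the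
half-axis of sign `e`, and by zero elsewhere. -/
def IsTailExt (q e : ℝ) (k : ℕ) (g F : ℝ → ℂ) : Prop :=
  (∀ n : ℕ, ∀ t ∈ Set.Ico q 1, F (e * (q ^ (2 * n + k) * t)) = g t) ∧
  (∀ t : ℝ, (¬ ∃ n : ℕ, ∃ s ∈ Set.Ico q 1, t = e * (q ^ (2 * n + k) * s)) → F t = 0)

theorem isEvenExt_iff {g F : ℝ → ℂ} : IsEvenExt q g F ↔ IsTailExt q 1 0 g F := by
  simp [IsEvenExt, IsTailExt]

theorem isOddExt_iff {g F : ℝ → ℂ} : IsOddExt q g F ↔ IsTailExt q 1 1 g F := by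
  simp [IsOddExt, IsTailExt]

theorem isEvenExtNeg_iff {g F : ℝ → ℂ} : IsEvenExtNeg q g F ↔ IsTailExt q (-1) 0 g F := by
  simp [IsEvenExtNeg, IsTailExt]

theorem isOddExtNeg_iff {g F : ℝ → ℂ} : IsOddExtNeg q g F ↔ IsTailExt q (-1) 1 g F := by
  simp [IsOddExtNeg, IsTailExt]

theorem rung_natCast (e : ℝ) (n : ℕ) (s : ℝ) : rung q e n s = e * (q ^ n * s) := by
  rw [rung, zpow_natCast]

theorem IsTailExt.apply_rung (hq : 0 < q) (hq1 : q < 1) {e : ℝ} (he : e * e = 1) {k : ℕ}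
    {g F : ℝ → ℂ} (hF : IsTailExt q e k g F) (n : ℤ) {s : ℝ} (hs : s ∈ Set.Ico q 1) :
    F (rung q e n s) = if (k : ℤ) ≤ n ∧ Even (n - k) then g s else 0 := by
  split_ifs with hn
  · obtain ⟨m, hm⟩ := hn.2
    lift m to ℕ using by linarith [hn.1]
    rw [← hF.1 m s hs, ← rung_natCast]
    congr 2
    push_cast
    linarith
  · refine hF.2 _ ?_
    rintro ⟨m, t, ht, hmt⟩
    rw [← rung_natCast] at hmt
    have := (rung_inj hq hq1 he hs ht hmt).1
    refine hn ⟨by rw [this]; push_cast; linarith, ⟨m, by rw [this]; push_cast; ring⟩⟩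

theorem exists_isTailExt (hq : 0 < q) (hq1 : q < 1) {e : ℝ} (he : e * e = 1) (k : ℕ)
    (g : ℝ → ℂ) : ∃ F, IsTailExt q e k g F := by
  classical
  refine ⟨fun t => if ht : ∃ n : ℕ, ∃ s ∈ Set.Ico q 1, t = e * (q ^ (2 * n + k) * s) then
    g ht.choose_spec.choose else 0, fun n t ht => ?_, fun t ht => dif_neg ht⟩
  have hx : ∃ m : ℕ, ∃ s ∈ Set.Ico q 1,
      e * (q ^ (2 * n + k) * t) = e * (q ^ (2 * m + k) * s) := ⟨n, t, ht, rfl⟩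
  refine (dif_pos hx).trans ?_
  have h1 := hx.choose_spec.choose_spec
  have h2 := (rung_natCast e (2 * n + k) t).trans (h1.2.trans (rung_natCast e _ _).symm)
  exact congrArg g (rung_inj hq hq1 he ht h1.1 h2).2.symm

theorem eq_add_tails_iff (hq : 0 < q) (hq1 : q < 1)
    (h : ∀ j, IsInduced q (e j) (μ1 j) (μ j))
    {E : ℤ → HS (fun j => wd (μ1 j)) →L[ℂ] HS μ}
    {N : HS (fun j => wd (μ1 j)) →L[ℂ] HS (fun j => wd (μ1 j))}
    (hL : IsLadder √q A E M N σ)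
    (hA : ∀ n f j, ∀ᵐ s ∂wd (μ1 j), A n f j s = f j (rung q (e j) n s))
    (f g : HS μ) (a b : HS (fun j => wd (μ1 j))) :
    f = g + (hL.tail 0 a + hL.tail 1 b) ↔ ∀ j, ∃ u v : ℝ → ℂ,
      IsTailExt q (e j) 0 (a j) u ∧ IsTailExt q (e j) 1 (b j) v ∧
      ∀ᵐ t ∂μ j, f j t = g j t + u t + v t := by
  classical
  have ht : ∀ (p : ℕ) (a : HS (fun j => wd (μ1 j))) (j : I) (n : ℤ), ∀ᵐ s ∂wd (μ1 j),
      hL.tail p a j (rung q (e j) n s) =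
        if (p : ℤ) ≤ n ∧ Even (n - p) then a j s else 0 := by
    intro p a j n
    have h0 := hA n (hL.tail p a) j
    rw [hL.A_tail] at h0
    split_ifs at h0 ⊢
    · filter_upwards [h0] with s hs
      exact hs.symm
    · filter_upwards [h0, Lp.coeFn_zero ℂ 2 (wd (μ1 j))] with s hs hs'
      exact hs.symm.trans hs'
  have hmem : ∀ j, ∀ᵐ s ∂wd (μ1 j), s ∈ Set.Ico q 1 := fun j => ((h j).ae_wd hq).2 (h j).ae_mem
  have key : ∀ j u v, IsTailExt q (e j) 0 (a j) u → IsTailExt q (e j) 1 (b j) v →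
      ∀ᵐ t ∂μ j, (g + (hL.tail 0 a + hL.tail 1 b)) j t = g j t + u t + v t := by
    intro j u v hu hv
    have h1 : ∀ᵐ t ∂μ j, hL.tail 0 a j t = u t := by
      rw [(h j).ae_iff hq hq1]
      intro n
      filter_upwards [ht 0 a j n, hmem j] with s hs hs'
      exact hs.trans (hu.apply_rung hq hq1 (h j).sign n hs').symm
    have h2 : ∀ᵐ t ∂μ j, hL.tail 1 b j t = v t := by
      rw [(h j).ae_iff hq hq1]
      intro n
      filter_upwards [ht 1 b j n, hmem j] with s hs hs'
      exact hs.trans (hv.apply_rung hq hq1 (h j).sign n hs').symm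
    filter_upwards [h1, h2, HS_add_apply g (hL.tail 0 a + hL.tail 1 b) j,
      HS_add_apply (hL.tail 0 a) (hL.tail 1 b) j] with t h1 h2 h3 h4
    rw [h3, h4, h1, h2, add_assoc]
  constructor
  · rintro rfl j
    obtain ⟨u, hu⟩ := exists_isTailExt hq hq1 (h j).sign 0 (a j)
    obtain ⟨v, hv⟩ := exists_isTailExt hq hq1 (h j).sign 1 (b j)
    exact ⟨u, v, hu, hv, key j u v hu hv⟩
  · intro hf
    refine HS_ext fun j => ?_
    obtain ⟨u, v, hu, hv, huv⟩ := hf j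
    filter_upwards [huv, key j u v hu hv] with t h1 h2
    rw [h1, h2]

end Coordinates

/-- The splitting of an `l²`-direct sum over a disjoint union of index types. -/
def lpSumEquiv {I J : Type*} (E : I ⊕ J → Type*) [∀ j, NormedAddCommGroup (E j)]
    [∀ j, NormedSpace ℂ (E j)] :
    lp E 2 ≃ₗ[ℂ] lp (fun j => E (Sum.inl j)) 2 × lp (fun j => E (Sum.inr j)) 2 where
  toFun x :=
    (⟨fun j => x (Sum.inl j), memℓp_gen <|
      ((lp.memℓp x).summable (by simp)).comp_injective Sum.inl_injective⟩,
    ⟨fun j => x (Sum.inr j), memℓp_gen <|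
      ((lp.memℓp x).summable (by simp)).comp_injective Sum.inr_injective⟩)
  invFun y := ⟨fun j => Sum.rec (motive := E) (fun i => y.1 i) (fun i => y.2 i) j,
    memℓp_gen <| Summable.sum _ ((lp.memℓp y.1).summable (by simp))
      ((lp.memℓp y.2).summable (by simp))⟩
  map_add' _ _ := rfl
  map_smul' _ _ := rfl
  left_inv x := by ext (j | j) <;> rfl
  right_inv y := rfl

theorem inner_lpSumEquiv {I J : Type*} (E : I ⊕ J → Type*) [∀ j, NormedAddCommGroup (E j)]
    [∀ j, InnerProductSpace ℂ (E j)] (x y : lp E 2) :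
    inner ℂ x y = inner ℂ (lpSumEquiv E x).1 (lpSumEquiv E y).1 +
      inner ℂ (lpSumEquiv E x).2 (lpSumEquiv E y).2 := by
  rw [lp.inner_eq_tsum, lp.inner_eq_tsum, lp.inner_eq_tsum]
  have hs := lp.summable_inner (𝕜 := ℂ) x y
  exact Summable.tsum_sum (hs.comp_injective Sum.inl_injective) (hs.comp_injective Sum.inr_injective)

theorem IsInducedPlus.isInduced {q : ℝ} {μ1 μ : Measure ℝ} (h : IsInducedPlus q μ1 μ)
    (hs : μ1 (Set.Ico q 1)ᶜ = 0) : IsInduced q 1 μ1 μ where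
  sign := one_mul 1
  null := by simp only [one_mul]; exact h.1
  image S hS hS' n := by
    rw [show rung q 1 n = fun t => q ^ n * t from funext fun t => one_mul _]
    exact h.2 S hS hS' n
  supp := hs

theorem IsInducedMinus.isInduced {q : ℝ} {μ1 μ : Measure ℝ} (h : IsInducedMinus q μ1 μ)
    (hs : μ1 (Set.Ico q 1)ᶜ = 0) : IsInduced q (-1) μ1 μ where
  sign := by norm_num
  null := by simp only [neg_one_mul, neg_pos]; exact h.1
  image S hS hS' n := by
    rw [show rung q (-1) n = fun t => -(q ^ n * t) from funext fun t => neg_one_mul _]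
    exact h.2 S hS hS' n
  supp := hs

/-- **Proposition 3, converse part.** If `X̃` is a self-adjoint extension
of `X` on `H` with `U D(X̃) ⊆ D(X̃)`, then there are unitaries `V, W : 𝕳₋ → 𝕳₊` such that
`X̃ = X_{V,W}`, i.e. the domain of `X̃` is exactly the set cut out by the boundary
conditions given by `V` and `W` (and `X̃` is the corresponding restriction of `X*`). -/
theorem stmt_12 (q : ℝ) (hq0 : 0 < q) (hq1 : q < 1)
    {Ip Im : Type} (μ1p : Ip → Measure ℝ) (μ1m : Im → Measure ℝ)
    [∀ j, IsFiniteMeasure (μ1p j)] [∀ j, IsFiniteMeasure (μ1m j)]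
    (hsp : ∀ j, μ1p j (Set.Ico q 1)ᶜ = 0) (hsm : ∀ j, μ1m j (Set.Ico q 1)ᶜ = 0)
    (μp : Ip → Measure ℝ) (μm : Im → Measure ℝ)
    (hp : ∀ j, IsInducedPlus q (μ1p j) (μp j))
    (hm : ∀ j, IsInducedMinus q (μ1m j) (μm j))
    (U : HS (Sum.elim μp μm) ≃ₗᵢ[ℂ] HS (Sum.elim μp μm))
    (hU : IsUop q (Sum.elim μp μm) U)
    (X : HS (Sum.elim μp μm) →ₗ.[ℂ] HS (Sum.elim μp μm))
    (hX : IsXop q (Sum.elim μp μm) X)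
    (Y : HS (Sum.elim μp μm) →ₗ.[ℂ] HS (Sum.elim μp μm))
    (hXY : X ≤ Y) (hYsa : IsSelfAdjoint Y)
    (hUdom : ∀ f : HS (Sum.elim μp μm), f ∈ Y.domain → U f ∈ Y.domain) :
    ∃ V W : HS (fun j => wd (μ1m j)) ≃ₗᵢ[ℂ] HS (fun j => wd (μ1p j)),
      ∀ f : HS (Sum.elim μp μm),
        f ∈ Y.domain ↔ MemXVW q μp μm μ1p μ1m X V W f := by
  let e : Ip ⊕ Im → ℝ := Sum.elim (fun _ => 1) (fun _ => -1)
  have h : ∀ j, IsInduced q (e j) (Sum.elim μ1p μ1m j) (Sum.elim μp μm j) := by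
    rintro (j | j)
    · exact (hp j).isInduced (hsp j)
    · exact (hm j).isInduced (hsm j)
  obtain ⟨A, E, M, N, σ, hL, hA, hM, hσ⟩ := exists_isLadder hq0 hq1 h
  have hLX := isLadderDiff_of_isXop hq0 hq1 h hA hM hσ hX
  let ρ : HS (fun j => wd (Sum.elim μ1p μ1m j)) ≃ₗ[ℂ]
      HS (fun j => wd (μ1p j)) × HS (fun j => wd (μ1m j)) :=
    lpSumEquiv fun j => Lp ℂ 2 (wd (Sum.elim μ1p μ1m j))
  have hρ1 : ∀ x, (ρ (σ x)).1 = (ρ x).1 := fun x => HS_ext fun j => by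
    filter_upwards [hσ x (Sum.inl j)] with s hs
    refine hs.trans ?_
    simp [e]
    rfl
  have hρ2 : ∀ x, (ρ (σ x)).2 = -(ρ x).2 := fun x => HS_ext fun j => by
    filter_upwards [hσ x (Sum.inr j), Lp.coeFn_neg ((ρ x).2 j)] with s hs hs'
    refine hs.trans (Eq.trans ?_ hs'.symm)
    simp [e]
    rfl
  have hρ : ∀ x y, inner ℂ (σ x) y =
      inner ℂ (ρ x).1 (ρ y).1 - inner ℂ (ρ x).2 (ρ y).2 := fun x y => by
    have := inner_lpSumEquiv (fun j => Lp ℂ 2 (wd (Sum.elim μ1p μ1m j))) (σ x) y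
    refine this.trans ?_
    change inner ℂ (ρ (σ x)).1 (ρ y).1 + inner ℂ (ρ (σ x)).2 (ρ y).2 = _
    rw [hρ1, hρ2, inner_neg_left, sub_eq_add_neg]
  obtain ⟨V, W, hVW⟩ := hL.exists_unitaries hLX
    (U := (U.toContinuousLinearEquiv : _ →L[ℂ] _))
    (fun n f => rungRestrict_of_isUop hq0 hq1 h hA hU n f)
    (ContinuousLinearMap.opNorm_le_bound _ zero_le_one fun f => by
      rw [one_mul]; exact (U.norm_map f).le) hXY hYsa hUdom ρ hρ
  refine ⟨V, W, fun f => (hVW f).trans ?_⟩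
  have hb : ∀ a b, (f ∈ X.adjoint.domain ∧ ∃ fX ∈ X.domain, f = fX + (hL.tail 0 a + hL.tail 1 b)) ↔
      IsBdry q μp μm μ1p μ1m X f (ρ a).1 (ρ b).1 (ρ a).2 (ρ b).2 := fun a b => by
    refine and_congr_right fun _ => exists_congr fun fX => and_congr_right fun _ => ?_
    rw [eq_add_tails_iff hq0 hq1 h hL hA, Sum.forall]
    simp only [isEvenExt_iff, isOddExt_iff, isEvenExtNeg_iff, isOddExtNeg_iff]
    exact Iff.rfl
  constructor
  · rintro ⟨a, b, hf, hV, hW⟩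
    exact ⟨_, _, _, _, (hb a b).1 hf, hV, hW⟩
  · rintro ⟨be, bo, ce, co, hf, hV, hW⟩
    refine ⟨ρ.symm (be, ce), ρ.symm (bo, co), (hb _ _).2 ?_, ?_, ?_⟩
    all_goals simpa only [LinearEquiv.apply_symm_apply] using by assumption

end
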